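/- arXiv:1504.06238 — 4 statements merged into one kernel-verified Lean document; each statement's English description precedes it below -/
import Mathlib

section
/- Fix an integer k ≥ 2 and ε > 0. Let v_1, v_2 be two vertices chosen independently and uniformly at random from [n], independently of the random k-out digraph 𝒟_{n,k}, and let H_n = dist(v_1, v_2) (the length of the shortest directed path from v_1 to v_2, with H_n = ∞ if v_2 is not reachable from v_1). Then P( |H_n / log_k n − 1| > ε | H_n < ∞ ) → 0 as n → ∞. -/
open scoped Classical
open Filter MeasureTheory

/-- Probability of an event under the uniform random `k`-out digraph model `𝒟_{n,k}`:
a uniformly random function `f : [n] × [k] → [n]`. -/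
noncomputable def prob (n k : ℕ) (P : (Fin n × Fin k → Fin n) → Prop) : ℝ :=
  ((Finset.univ.filter P).card : ℝ) / (Fintype.card (Fin n × Fin k → Fin n) : ℝ)

/-- One arc step: there is a labeled arc from `u` to `v`. -/
def Step {n k : ℕ} (f : Fin n × Fin k → Fin n) (u v : Fin n) : Prop :=
  ∃ i : Fin k, f (u, i) = v

/-- `u` reaches `v` by following finitely many arcs. -/
def Reaches {n k : ℕ} (f : Fin n × Fin k → Fin n) : Fin n → Fin n → Prop :=
  Relation.ReflTransGen (Step f)

/-- A set of vertices is closed if no arc leaves it. -/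
def IsClosedSet {n k : ℕ} (f : Fin n × Fin k → Fin n) (S : Set (Fin n)) : Prop :=
  ∀ v ∈ S, ∀ i : Fin k, f (v, i) ∈ S

/-- A set of vertices is strongly connected if it is nonempty and
any two of its vertices reach each other. -/
def IsStrConn {n k : ℕ} (f : Fin n × Fin k → Fin n) (S : Set (Fin n)) : Prop :=
  S.Nonempty ∧ ∀ u ∈ S, ∀ v ∈ S, Reaches f u v

/-- `G` is the giant: a closed strongly connected set of maximum size,
ties broken by choosing the one containing the smallest vertex label. -/
def IsGiant {n k : ℕ} (f : Fin n × Fin k → Fin n) (G : Set (Fin n)) : Prop :=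
  IsClosedSet f G ∧ IsStrConn f G ∧
    (∀ S : Set (Fin n), IsClosedSet f S → IsStrConn f S → S.ncard ≤ G.ncard) ∧
    (∀ S : Set (Fin n), IsClosedSet f S → IsStrConn f S → S.ncard = G.ncard →
      ∃ v ∈ G, ∀ u ∈ S, v ≤ u)

/-- `pathDist f u v`: the length of the shortest directed path from `u` to `v`
(`⊤` if `v` is not reachable from `u`). -/
noncomputable def pathDist {n k : ℕ} (f : Fin n × Fin k → Fin n) (u v : Fin n) : ℕ∞ :=
  sInf {ℓ : ℕ∞ | ∃ m : ℕ, ℓ = (m : ℕ∞) ∧ ∃ c : Fin (m + 1) → Fin n,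
    c 0 = u ∧ c (Fin.last m) = v ∧ ∀ j : Fin m, ∃ i : Fin k, f (c j.castSucc, i) = c j.succ}

/-- Probability over the uniform random `k`-out digraph together with two
independent uniformly random vertices `v₁, v₂`. -/
noncomputable def prob2 (n k : ℕ)
    (P : (Fin n × Fin k → Fin n) → Fin n → Fin n → Prop) : ℝ :=
  ((Finset.univ.filter fun x : (Fin n × Fin k → Fin n) × Fin n × Fin n =>
      P x.1 x.2.1 x.2.2).card : ℝ) /
    (Fintype.card ((Fin n × Fin k → Fin n) × Fin n × Fin n) : ℝ)

section PathLemmas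

variable {n k : ℕ}

/-- There is a directed path of length `m` from `u` to `v`. -/
def HasPath (f : Fin n × Fin k → Fin n) (m : ℕ) (u v : Fin n) : Prop :=
  ∃ c : Fin (m + 1) → Fin n,
    c 0 = u ∧ c (Fin.last m) = v ∧ ∀ j : Fin m, ∃ i : Fin k, f (c j.castSucc, i) = c j.succ

lemma hasPath_zero (f : Fin n × Fin k → Fin n) (u v : Fin n) : HasPath f 0 u v ↔ u = v := by
  constructor
  · rintro ⟨c, h0, h1, -⟩
    rw [← h0, ← h1]; rfl
  · rintro rfl
    exact ⟨fun _ => u, rfl, rfl, fun j => j.elim0⟩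

lemma hasPath_succ (f : Fin n × Fin k → Fin n) (m : ℕ) (u v : Fin n) :
    HasPath f (m + 1) u v ↔ ∃ i, HasPath f m (f (u, i)) v := by
  constructor
  · rintro ⟨c, h0, h1, h⟩
    obtain ⟨i, hi⟩ := h 0
    refine ⟨i, fun j => c j.succ, ?_, by simpa using h1, fun j => ?_⟩
    · rw [← h0]; simpa using hi.symm
    · simpa using h j.succ
  · rintro ⟨i, c, h0, h1, h⟩
    refine ⟨Fin.cons u c, rfl, ?_, fun j => ?_⟩
    · rw [← Fin.succ_last, Fin.cons_succ, h1]
    · refine Fin.cases ⟨i, ?_⟩ (fun j => ?_) j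
      · simp [h0]
      · obtain ⟨l, hl⟩ := h j
        exact ⟨l, by rw [← Fin.succ_castSucc, Fin.cons_succ, Fin.cons_succ, hl]⟩

lemma hasPath_of_pathDist_eq {f : Fin n × Fin k → Fin n} {u v : Fin n} {h : ℕ}
    (hd : pathDist f u v = (h : ℕ∞)) : HasPath f h u v := by
  have hne : {ℓ : ℕ∞ | ∃ m : ℕ, ℓ = (m : ℕ∞) ∧ HasPath f m u v}.Nonempty := by
    by_contra hcon
    have : pathDist f u v = ⊤ := by
      change sInf {ℓ : ℕ∞ | ∃ m : ℕ, ℓ = (m : ℕ∞) ∧ HasPath f m u v} = ⊤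
      rw [Set.not_nonempty_iff_eq_empty.mp hcon, sInf_empty]
    rw [this] at hd
    exact absurd hd.symm (ENat.natCast_ne_top h)
  obtain ⟨m, hm, hp⟩ := csInf_mem hne
  have : (h : ℕ∞) = m := hd.symm.trans hm
  rwa [Nat.cast_inj.mp this]

lemma pathDist_le_of_hasPath {f : Fin n × Fin k → Fin n} {u v : Fin n} {m : ℕ}
    (hp : HasPath f m u v) : pathDist f u v ≤ m :=
  sInf_le ⟨m, rfl, hp⟩

lemma card_hasPath_le (f : Fin n × Fin k → Fin n) (m : ℕ) (u : Fin n) :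
    (Finset.univ.filter fun v => HasPath f m u v).card ≤ k ^ m := by
  induction m generalizing u with
  | zero =>
    simp only [hasPath_zero, pow_zero]
    exact Finset.card_le_one.mpr (by simp_all)
  | succ m ih =>
    have : (Finset.univ.filter fun v => HasPath f (m + 1) u v) =
        Finset.univ.biUnion fun i => Finset.univ.filter fun v => HasPath f m (f (u, i)) v := by
      ext v; simp [hasPath_succ]
    rw [this]
    refine Finset.card_biUnion_le.trans ((Finset.sum_le_sum fun i _ => ih _).trans ?_)
    simp [pow_succ, mul_comm]

/-- The vertices from which `v` can be reached along fewer than `r` arcs. -/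
def inBall (f : Fin n × Fin k → Fin n) (v : Fin n) : ℕ → Finset (Fin n)
  | 0 => ∅
  | r + 1 => Finset.univ.filter fun u => u = v ∨ ∃ i, f (u, i) ∈ inBall f v r

lemma mem_inBall_succ {f : Fin n × Fin k → Fin n} {v u : Fin n} {r : ℕ} :
    u ∈ inBall f v (r + 1) ↔ u = v ∨ ∃ i, f (u, i) ∈ inBall f v r := by
  simp [inBall]

lemma mem_inBall_iff {f : Fin n × Fin k → Fin n} {v u : Fin n} {r : ℕ} :
    u ∈ inBall f v r ↔ ∃ m < r, HasPath f m u v := by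
  induction r generalizing u with
  | zero => simp [inBall]
  | succ r ih =>
    rw [mem_inBall_succ]
    constructor
    · rintro (rfl | ⟨i, hi⟩)
      · exact ⟨0, by omega, (hasPath_zero _ _ _).2 rfl⟩
      · obtain ⟨m, hm, hp⟩ := ih.1 hi
        exact ⟨m + 1, by omega, (hasPath_succ _ _ _ _).2 ⟨i, hp⟩⟩
    · rintro ⟨m, hm, hp⟩
      cases m with
      | zero => exact Or.inl ((hasPath_zero _ _ _).1 hp)
      | succ m =>
        obtain ⟨i, hi⟩ := (hasPath_succ _ _ _ _).1 hp
        exact Or.inr ⟨i, ih.2 ⟨m, by omega, hi⟩⟩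

lemma inBall_mono (f : Fin n × Fin k → Fin n) (v : Fin n) : Monotone (inBall f v) := by
  intro r s hrs u hu
  obtain ⟨m, hm, hp⟩ := mem_inBall_iff.1 hu
  exact mem_inBall_iff.2 ⟨m, by omega, hp⟩

lemma inBall_eq_of_succ_eq {f : Fin n × Fin k → Fin n} {v : Fin n} {r : ℕ}
    (h : inBall f v (r + 1) = inBall f v r) (s : ℕ) : inBall f v (r + s) = inBall f v r := by
  induction s with
  | zero => rfl
  | succ s ih =>
    rw [← h]
    ext u
    rw [← add_assoc, mem_inBall_succ, mem_inBall_succ, ih]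

/-- Number of vertices outside the in-ball. -/
def outCount (f : Fin n × Fin k → Fin n) (v : Fin n) (r : ℕ) : ℕ := (inBall f v r)ᶜ.card

lemma outCount_antitone (f : Fin n × Fin k → Fin n) (v : Fin n) : Antitone (outCount f v) :=
  fun _ _ h => Finset.card_le_card (Finset.compl_subset_compl.2 (inBall_mono f v h))

lemma outCount_le (f : Fin n × Fin k → Fin n) (v : Fin n) (r : ℕ) : outCount f v r ≤ n :=
  (Finset.card_le_univ _).trans (by simp)

lemma inBall_eq_of_outCount_eq {f : Fin n × Fin k → Fin n} {v : Fin n} {r : ℕ}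
    (h : outCount f v (r + 1) = outCount f v r) (s : ℕ) : inBall f v (r + s) = inBall f v r := by
  refine inBall_eq_of_succ_eq ?_ s
  have := Finset.eq_of_subset_of_card_le
    (Finset.compl_subset_compl.2 (inBall_mono f v (Nat.le_succ r))) h.ge
  exact compl_injective this

end PathLemmas

section Resampling

variable {n k : ℕ}

/-- The arc maps whose in-balls of radii `r` and `r + 1` around `v` are `A` and `U`. -/
noncomputable def exploredAs (k : ℕ) (v : Fin n) (r : ℕ) (A U : Finset (Fin n)) :
    Finset (Fin n × Fin k → Fin n) :=
  Finset.univ.filter fun f => inBall f v r = A ∧ inBall f v (r + 1) = U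

/-- The arc maps sending no vertex outside `U` into `A`. -/
noncomputable def avoiding (k : ℕ) (A U : Finset (Fin n)) : Finset (Fin n × Fin k → Fin n) :=
  Finset.univ.filter fun g => ∀ u ∉ U, ∀ i, g (u, i) ∉ A

/-- The arcs of `f` at vertices of `U`, and those of `g` elsewhere. -/
def splice (U : Finset (Fin n)) (f g : Fin n × Fin k → Fin n) : Fin n × Fin k → Fin n :=
  fun x => if x.1 ∈ U then f x else g x

/-- Number of vertices outside `U` with an arc into `U`. -/
noncomputable def hitCount (U : Finset (Fin n)) (g : Fin n × Fin k → Fin n) : ℕ :=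
  (Finset.univ.filter fun u => u ∉ U ∧ ∃ i, g (u, i) ∈ U).card

lemma splice_splice (U : Finset (Fin n)) (f g : Fin n × Fin k → Fin n) :
    splice U (splice U f g) (splice U g f) = f := by
  funext x
  by_cases h : x.1 ∈ U <;> simp [splice, h]

lemma hitCount_splice (U : Finset (Fin n)) (f g : Fin n × Fin k → Fin n) :
    hitCount U (splice U f g) = hitCount U g := by
  unfold hitCount
  congr 1
  ext u
  simp only [Finset.mem_filter, Finset.mem_univ, true_and]
  by_cases h : u ∈ U <;> simp [splice, h]

lemma mem_avoiding_of_mem_exploredAs {v : Fin n} {r : ℕ} {A U : Finset (Fin n)}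
    {f : Fin n × Fin k → Fin n} (hf : f ∈ exploredAs k v r A U) : f ∈ avoiding k A U := by
  simp only [exploredAs, avoiding, Finset.mem_filter, Finset.mem_univ, true_and] at *
  obtain ⟨rfl, rfl⟩ := hf
  intro u hu i hi
  exact hu (mem_inBall_succ.2 (Or.inr ⟨i, hi⟩))

lemma splice_mem_avoiding {A U : Finset (Fin n)} (f : Fin n × Fin k → Fin n)
    {g : Fin n × Fin k → Fin n} (hg : g ∈ avoiding k A U) : splice U f g ∈ avoiding k A U := by
  simp only [avoiding, Finset.mem_filter, Finset.mem_univ, true_and] at *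
  intro u hu i
  simpa [splice, hu] using hg u hu i

lemma splice_mem_exploredAs {v : Fin n} {r : ℕ} {A U : Finset (Fin n)}
    {f g : Fin n × Fin k → Fin n} (hf : f ∈ exploredAs k v r A U) (hg : g ∈ avoiding k A U) :
    splice U f g ∈ exploredAs k v r A U := by
  simp only [exploredAs, avoiding, Finset.mem_filter, Finset.mem_univ, true_and] at *
  obtain ⟨rfl, rfl⟩ := hf
  set U := inBall f v (r + 1) with hU
  have key : ∀ j ≤ r + 1, inBall (splice U f g) v j = inBall f v j := by
    intro j
    induction j with
    | zero => intro _; rfl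
    | succ j ih =>
      intro hj
      ext u
      rw [mem_inBall_succ, mem_inBall_succ, ih (by omega)]
      by_cases hu : u ∈ U
      · simp [splice, hu]
      · have h1 : ∀ i, g (u, i) ∉ inBall f v j := fun i hi =>
          hg u hu i (inBall_mono f v (by omega) hi)
        have h2 : ∀ i, f (u, i) ∉ inBall f v j := fun i hi =>
          hu (inBall_mono f v hj (mem_inBall_succ.2 (Or.inr ⟨i, hi⟩)))
        simp [splice, hu, h1, h2]
  exact ⟨key r (by omega), key (r + 1) le_rfl⟩

lemma hitCount_add_outCount (f : Fin n × Fin k → Fin n) (v : Fin n) (r : ℕ) :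
    hitCount (inBall f v (r + 1)) f + outCount f v (r + 2) = outCount f v (r + 1) := by
  have hv : v ∈ inBall f v (r + 1) := mem_inBall_succ.2 (Or.inl rfl)
  have : (Finset.univ.filter fun u => u ∉ inBall f v (r + 1) ∧
      ∃ i, f (u, i) ∈ inBall f v (r + 1)) = (inBall f v (r + 1))ᶜ \ (inBall f v (r + 2))ᶜ := by
    ext u
    simp only [Finset.mem_filter, Finset.mem_univ, true_and, Finset.mem_sdiff, Finset.mem_compl,
      not_not, mem_inBall_succ (r := r + 1)]
    constructor
    · rintro ⟨h1, h2⟩; exact ⟨h1, Or.inr h2⟩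
    · rintro ⟨h1, rfl | h2⟩
      · exact absurd hv h1
      · exact ⟨h1, h2⟩
  unfold hitCount outCount
  rw [this]
  exact Finset.card_sdiff_add_card_eq_card
    (Finset.compl_subset_compl.2 (inBall_mono f v (Nat.le_succ _)))

/-- Resampling the unexplored arcs preserves the law of the explored part. -/
lemma sum_exploredAs_mul_card (v : Fin n) (r : ℕ) (A U : Finset (Fin n)) (l : ℝ) :
    (∑ f ∈ exploredAs k v r A U, l ^ hitCount U f) * (avoiding k A U).card =
      (exploredAs k v r A U).card * ∑ g ∈ avoiding k A U, l ^ hitCount U g := by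
  have h1 : ∑ p ∈ exploredAs k v r A U ×ˢ avoiding k A U, l ^ hitCount U p.1 =
      ∑ p ∈ exploredAs k v r A U ×ˢ avoiding k A U, l ^ hitCount U p.2 := by
    refine Finset.sum_nbij' (fun p => (splice U p.1 p.2, splice U p.2 p.1))
      (fun p => (splice U p.1 p.2, splice U p.2 p.1)) ?_ ?_ ?_ ?_ ?_
    · rintro ⟨f, g⟩ h
      rw [Finset.mem_product] at h ⊢
      exact ⟨splice_mem_exploredAs h.1 h.2,
        splice_mem_avoiding _ (mem_avoiding_of_mem_exploredAs h.1)⟩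
    · rintro ⟨f, g⟩ h
      rw [Finset.mem_product] at h ⊢
      exact ⟨splice_mem_exploredAs h.1 h.2,
        splice_mem_avoiding _ (mem_avoiding_of_mem_exploredAs h.1)⟩
    · rintro ⟨f, g⟩ -
      simp [splice_splice]
    · rintro ⟨f, g⟩ -
      simp [splice_splice]
    · rintro ⟨f, g⟩ -
      simp [hitCount_splice]
  rw [Finset.sum_product, Finset.sum_product] at h1
  simp only [Finset.sum_const, nsmul_eq_mul] at h1
  rw [← h1, Finset.sum_mul]
  exact Finset.sum_congr rfl fun _ _ => mul_comm _ _

/-- Generating function of the number of hits of a uniform map avoiding `A` outside `U`. -/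
lemma sum_avoiding (A U : Finset (Fin n)) (hAU : A ⊆ U) (l : ℝ) :
    ∑ g ∈ avoiding k A U, l ^ hitCount U g =
      ((n : ℝ) ^ k) ^ U.card *
        ((Uᶜ.card : ℝ) ^ k + l * ((Aᶜ.card : ℝ) ^ k - (Uᶜ.card : ℝ) ^ k)) ^ Uᶜ.card := by
  let t : Fin n → Finset (Fin k → Fin n) := fun u =>
    if u ∈ U then Finset.univ else Fintype.piFinset fun _ => Aᶜ
  let w : Fin n → (Fin k → Fin n) → ℝ := fun u h =>
    if u ∉ U ∧ ∃ i, h i ∈ U then l else 1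
  have h1 : ∑ g ∈ avoiding k A U, l ^ hitCount U g =
      ∑ h ∈ Fintype.piFinset t, ∏ u, w u (h u) := by
    refine Finset.sum_nbij' (fun g u i => g (u, i)) (fun h x => h x.1 x.2) ?_ ?_ ?_ ?_ ?_
    · intro g hg
      simp only [avoiding, Finset.mem_filter, Finset.mem_univ, true_and] at hg
      rw [Fintype.mem_piFinset]
      intro u
      by_cases hu : u ∈ U
      · simp [t, hu]
      · simpa [t, hu] using hg u hu
    · intro h hh
      rw [Fintype.mem_piFinset] at hh
      simp only [avoiding, Finset.mem_filter, Finset.mem_univ, true_and]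
      intro u hu i
      have := hh u
      simp only [t, hu, if_false, Fintype.mem_piFinset, Finset.mem_compl] at this
      exact this i
    · intro g _; rfl
    · intro h _; rfl
    · intro g _
      simp only [w, hitCount]
      rw [Finset.prod_ite]
      simp
  have h2 : ∀ u ∈ U, ∑ h ∈ t u, w u h = (n : ℝ) ^ k := by
    intro u hu
    simp [t, w, hu]
  have h3 : ∀ u ∈ Uᶜ, ∑ h ∈ t u, w u h =
      (Uᶜ.card : ℝ) ^ k + l * ((Aᶜ.card : ℝ) ^ k - (Uᶜ.card : ℝ) ^ k) := by
    intro u hu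
    rw [Finset.mem_compl] at hu
    have e : ((Fintype.piFinset fun _ : Fin k => Aᶜ).filter fun h => ¬ ∃ i, h i ∈ U) =
        Fintype.piFinset fun _ : Fin k => Uᶜ := by
      ext h
      simp only [Finset.mem_filter, Fintype.mem_piFinset, Finset.mem_compl, not_exists]
      exact ⟨fun h' => h'.2, fun h' => ⟨fun i hi => h' i (hAU hi), h'⟩⟩
    have e2 := Finset.card_filter_add_card_filter_not
      (s := Fintype.piFinset fun _ : Fin k => Aᶜ) (fun h => ∃ i, h i ∈ U)
    rw [e, Fintype.card_piFinset, Fintype.card_piFinset] at e2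
    simp only [t, w, hu, if_false, not_false_eq_true, true_and]
    rw [Finset.sum_ite, e]
    simp only [Finset.prod_const, Finset.card_univ, Fintype.card_fin] at e2
    have e3 : (((Fintype.piFinset fun _ : Fin k => Aᶜ).filter fun h => ∃ i, h i ∈ U).card : ℝ) =
        (Aᶜ.card : ℝ) ^ k - (Uᶜ.card : ℝ) ^ k := by
      rw [eq_sub_iff_add_eq]
      exact_mod_cast e2
    simp only [Finset.sum_const, nsmul_eq_mul, Fintype.card_piFinset, Finset.prod_const,
      Finset.card_univ, Fintype.card_fin]
    rw [e3]
    push_cast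
    ring
  rw [h1, ← Finset.prod_univ_sum, ← Finset.prod_mul_prod_compl U, Finset.prod_congr rfl h2,
    Finset.prod_congr rfl h3, Finset.prod_const, Finset.prod_const]

lemma sum_exploredAs (v : Fin n) (r : ℕ) (A U : Finset (Fin n)) (hAU : A ⊆ U)
    (hn : 0 < n) (hA : 0 < Aᶜ.card) (l : ℝ) :
    ∑ f ∈ exploredAs k v r A U, l ^ hitCount U f =
      (exploredAs k v r A U).card *
        (1 - (1 - l) * (1 - ((Uᶜ.card : ℝ) / Aᶜ.card) ^ k)) ^ Uᶜ.card := by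
  have h := sum_exploredAs_mul_card (k := k) v r A U l
  have hc := sum_avoiding (k := k) A U hAU 1
  simp only [one_pow, Finset.sum_const, nsmul_eq_mul, mul_one, one_mul] at hc
  rw [hc, sum_avoiding A U hAU] at h
  have hA' : (0 : ℝ) < Aᶜ.card := by exact_mod_cast hA
  have hn' : (0 : ℝ) < n := by exact_mod_cast hn
  have e : (Uᶜ.card : ℝ) ^ k + l * ((Aᶜ.card : ℝ) ^ k - (Uᶜ.card : ℝ) ^ k) =
      (Aᶜ.card : ℝ) ^ k * (1 - (1 - l) * (1 - ((Uᶜ.card : ℝ) / Aᶜ.card) ^ k)) := by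
    rw [div_pow]
    field_simp
    ring
  rw [e, mul_pow, add_sub_cancel] at h
  have hpos : 0 < ((n : ℝ) ^ k) ^ U.card * ((Aᶜ.card : ℝ) ^ k) ^ Uᶜ.card := by positivity
  apply mul_right_cancel₀ hpos.ne'
  rw [h]
  ring

end Resampling

section RealInequalities

lemma exp_neg_le_quadratic {x : ℝ} (hx : 0 ≤ x) : Real.exp (-x) ≤ 1 - x + x ^ 2 / 2 := by
  have h := Real.quadratic_le_exp_of_nonneg hx
  have h2 : Real.exp (-x) * Real.exp x = 1 := by rw [← Real.exp_add]; simp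
  have h3 : 0 ≤ 1 - x + x ^ 2 / 2 := by nlinarith [sq_nonneg (x - 1)]
  have h4 : 1 ≤ (1 - x + x ^ 2 / 2) * Real.exp x := by
    calc (1 : ℝ) ≤ (1 - x + x ^ 2 / 2) * (1 + x + x ^ 2 / 2) := by nlinarith [sq_nonneg (x ^ 2)]
      _ ≤ _ := mul_le_mul_of_nonneg_left h h3
  exact le_of_mul_le_mul_right (h2.le.trans h4) (Real.exp_pos x)

lemma exp_neg_le_inv {x : ℝ} (hx : 0 < x) : Real.exp (-x) ≤ x⁻¹ := by
  rw [Real.exp_neg]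
  exact inv_anti₀ hx (by linarith [Real.add_one_le_exp x])

lemma exp_neg_two_mul_le_one_sub {x : ℝ} (h0 : 0 ≤ x) (h1 : x ≤ 1 / 2) :
    Real.exp (-(2 * x)) ≤ 1 - x := by
  have h : 0 < 1 - x := by linarith
  rw [← Real.le_log_iff_exp_le h]
  refine le_trans ?_ (Real.one_sub_inv_le_log_of_pos h)
  have : (1 - x)⁻¹ ≤ 1 + 2 * x := by
    rw [inv_le_iff_one_le_mul₀ h]
    nlinarith
  linarith

lemma one_sub_pow_mul_le_one {x : ℝ} (k : ℕ) (h0 : 0 ≤ x) (h1 : x ≤ 1) :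
    (1 - x) ^ k * (1 + k * x) ≤ 1 := by
  have hb := one_add_mul_le_pow (a := x) (by linarith) k
  calc (1 - x) ^ k * (1 + k * x) ≤ (1 - x) ^ k * (1 + x) ^ k :=
        mul_le_mul_of_nonneg_left hb (pow_nonneg (by linarith) k)
    _ = (1 - x ^ 2) ^ k := by rw [← mul_pow]; ring_nf
    _ ≤ 1 := pow_le_one₀ (by nlinarith) (by nlinarith)

/-- One generation of the in-ball multiplies a small frontier proportion `q` by almost `k`. -/
lemma growth_step {k : ℕ} {ξ θ q : ℝ} (hξ1 : ξ < 1) (hθ : 0 ≤ θ)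
    (hθq : θ ≤ q) (hq : q ≤ 1) (hkθ : k * θ ≤ ξ) :
    (1 - ξ) ^ 2 * k * θ ≤ (1 - ξ) * (1 - (1 - q) ^ k) := by
  have h1 : (1 - q) ^ k ≤ (1 - θ) ^ k := pow_le_pow_left₀ (by linarith) (by linarith) k
  have h2 := one_sub_pow_mul_le_one k hθ (hθq.trans hq)
  have hkθ0 : (0 : ℝ) ≤ k * θ := by positivity
  have h3 : (1 - θ) ^ k ≤ 1 - (1 - ξ) * (k * θ) := by
    have : 1 ≤ (1 - (1 - ξ) * (k * θ)) * (1 + k * θ) := by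
      have hx : 0 ≤ ξ - (1 - ξ) * (k * θ) := by nlinarith
      have := mul_nonneg hkθ0 hx
      linarith
    exact le_of_mul_le_mul_right (h2.trans this) (by linarith)
  calc (1 - ξ) ^ 2 * k * θ = (1 - ξ) * ((1 - ξ) * (k * θ)) := by ring
    _ ≤ _ := mul_le_mul_of_nonneg_left (by linarith) (by linarith)

end RealInequalities

section Prob

variable {n k : ℕ}

lemma prob_mono {P Q : (Fin n × Fin k → Fin n) → Prop} (h : ∀ f, P f → Q f) :
    prob n k P ≤ prob n k Q := by
  unfold prob
  gcongr with f
  exact h _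

lemma prob_le_one (P : (Fin n × Fin k → Fin n) → Prop) : prob n k P ≤ 1 := by
  unfold prob
  refine div_le_one_of_le₀ ?_ (by positivity)
  exact_mod_cast Finset.card_le_univ _

lemma prob_or_le (P Q : (Fin n × Fin k → Fin n) → Prop) :
    prob n k (fun f => P f ∨ Q f) ≤ prob n k P + prob n k Q := by
  unfold prob
  rw [← add_div]
  gcongr
  rw [← Nat.cast_add]
  exact Nat.cast_le.2 ((Finset.card_le_card fun f hf => by simpa using hf).trans
    (Finset.card_union_le _ _))

lemma prob_exists_lt_le (P : ℕ → (Fin n × Fin k → Fin n) → Prop) (J : ℕ) :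
    prob n k (fun f => ∃ j < J, P j f) ≤ ∑ j ∈ Finset.range J, prob n k (P j) := by
  induction J with
  | zero => simp [prob]
  | succ J ih =>
    rw [Finset.sum_range_succ]
    refine le_trans (prob_mono ?_) ((prob_or_le _ _).trans (add_le_add_left ih _))
    rintro f ⟨j, hj, h⟩
    rcases Nat.lt_succ_iff_lt_or_eq.1 hj with h' | rfl
    · exact Or.inl ⟨j, h', h⟩
    · exact Or.inr h

lemma sum_prob_le_one (P : ℕ → (Fin n × Fin k → Fin n) → Prop) (J : ℕ)
    (hP : ∀ i j f, i < j → P i f → ¬ P j f) : ∑ j ∈ Finset.range J, prob n k (P j) ≤ 1 := by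
  have h : ∑ j ∈ Finset.range J, (Finset.univ.filter (P j)).card ≤
      Fintype.card (Fin n × Fin k → Fin n) := by
    rw [← Finset.card_biUnion]
    · exact Finset.card_le_univ _
    · intro i _ j _ hij
      rw [Function.onFun, Finset.disjoint_filter]
      intro f _ hi hj
      rcases lt_or_gt_of_ne hij with h | h
      · exact hP i j f h hi hj
      · exact hP j i f h hj hi
  unfold prob
  rw [← Finset.sum_div]
  refine div_le_one_of_le₀ ?_ (by positivity)
  exact_mod_cast h

lemma card_filter_explored (v : Fin n) (r : ℕ) (P : (Fin n × Fin k → Fin n) → Prop) :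
    (Finset.univ.filter P).card = ∑ s : Finset (Fin n) × Finset (Fin n),
      ((exploredAs k v r s.1 s.2).filter P).card := by
  rw [Finset.card_eq_sum_card_fiberwise (f := fun f => (inBall f v r, inBall f v (r + 1)))
    (t := Finset.univ) (fun _ _ => Finset.mem_univ _)]
  refine Finset.sum_congr rfl fun s _ => ?_
  congr 1
  ext f
  simp [exploredAs, Prod.ext_iff, and_comm]

/-- An upper bound given the explored part is an upper bound on average. -/
lemma prob_and_le_of_explored (v : Fin n) (r : ℕ)
    (C : Finset (Fin n) → Finset (Fin n) → Prop) (Q : (Fin n × Fin k → Fin n) → Prop) (b : ℝ)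
    (h : ∀ A U, C A U → A ⊆ U →
      (((exploredAs k v r A U).filter Q).card : ℝ) ≤ b * (exploredAs k v r A U).card) :
    prob n k (fun f => C (inBall f v r) (inBall f v (r + 1)) ∧ Q f) ≤
      b * prob n k (fun f => C (inBall f v r) (inBall f v (r + 1))) := by
  unfold prob
  rw [← mul_div_assoc]
  gcongr
  rw [card_filter_explored v r, card_filter_explored v r
    (fun f => C (inBall f v r) (inBall f v (r + 1)))]
  push_cast
  rw [Finset.mul_sum]
  refine Finset.sum_le_sum ?_
  rintro ⟨A, U⟩ -
  simp only
  by_cases hC : C A U ∧ A ⊆ U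
  · refine le_trans ?_ ((h A U hC.1 hC.2).trans_eq ?_)
    · norm_cast
      refine Finset.card_le_card fun f hf => ?_
      simp only [Finset.mem_filter] at hf ⊢
      exact ⟨hf.1, hf.2.2⟩
    · rw [Finset.filter_true_of_mem]
      intro f hf
      simp only [exploredAs, Finset.mem_filter] at hf
      rw [hf.2.1, hf.2.2]; exact hC.1
  · have e : ∀ P : (Fin n × Fin k → Fin n) → Prop,
        (∀ f, P f → C (inBall f v r) (inBall f v (r + 1))) →
          (exploredAs k v r A U).filter P = ∅ := by
      intro P hP
      refine Finset.filter_eq_empty_iff.2 fun f hf hPf => hC ?_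
      simp only [exploredAs, Finset.mem_filter] at hf
      rw [← hf.2.1, ← hf.2.2]
      exact ⟨hP f hPf, inBall_mono f v (Nat.le_succ r)⟩
    rw [e _ fun f hf => hf.1, e _ fun f hf => hf]
    simp

/-- A lower bound given the explored part is a lower bound on average. -/
lemma le_prob_and_of_explored (v : Fin n) (r : ℕ)
    (C : Finset (Fin n) → Finset (Fin n) → Prop) (Q : (Fin n × Fin k → Fin n) → Prop) (b : ℝ)
    (h : ∀ A U, C A U → A ⊆ U →
      b * (exploredAs k v r A U).card ≤ (((exploredAs k v r A U).filter Q).card : ℝ)) :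
    b * prob n k (fun f => C (inBall f v r) (inBall f v (r + 1))) ≤
      prob n k (fun f => C (inBall f v r) (inBall f v (r + 1)) ∧ Q f) := by
  have h1 := prob_and_le_of_explored v r C (fun f => ¬ Q f) (1 - b) fun A U hC hA => by
    have := h A U hC hA
    have h' : (((exploredAs k v r A U).filter Q).card : ℝ) +
        ((exploredAs k v r A U).filter fun f => ¬ Q f).card = (exploredAs k v r A U).card := by
      exact_mod_cast Finset.card_filter_add_card_filter_not (s := exploredAs k v r A U) Q
    have e : (((exploredAs k v r A U).filter fun f => ¬ Q f).card : ℝ) ≤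
        (1 - b) * (exploredAs k v r A U).card := by linarith
    convert e
  have h2 := prob_or_le (n := n) (k := k)
    (fun f => C (inBall f v r) (inBall f v (r + 1)) ∧ Q f)
    (fun f => C (inBall f v r) (inBall f v (r + 1)) ∧ ¬ Q f)
  have h3 : prob n k (fun f => C (inBall f v r) (inBall f v (r + 1))) ≤
      prob n k (fun f => (C (inBall f v r) (inBall f v (r + 1)) ∧ Q f) ∨
        (C (inBall f v r) (inBall f v (r + 1)) ∧ ¬ Q f)) :=
    prob_mono fun f hf => by tauto
  linarith

end Prob

section OneGeneration

variable {n k : ℕ}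

lemma card_hitCount_lt_le (v : Fin n) (r : ℕ) (A U : Finset (Fin n)) (hAU : A ⊆ U)
    (hA : 0 < Aᶜ.card) {ξ y : ℝ} (hξ : 0 ≤ ξ)
    (hy : y ≤ Uᶜ.card * (1 - ((Uᶜ.card : ℝ) / Aᶜ.card) ^ k)) :
    (((exploredAs k v r A U).filter fun f => (hitCount U f : ℝ) <
      (1 - ξ) * (Uᶜ.card * (1 - ((Uᶜ.card : ℝ) / Aᶜ.card) ^ k))).card : ℝ) ≤
      Real.exp (-(ξ ^ 2 * y / 2)) * (exploredAs k v r A U).card := by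
  set N : ℝ := (Uᶜ.card : ℝ) with hN
  set p : ℝ := 1 - (N / Aᶜ.card) ^ k with hp
  set E := exploredAs k v r A U with hE
  have hA' : (0 : ℝ) < Aᶜ.card := by exact_mod_cast hA
  have hNA : N ≤ Aᶜ.card :=
    Nat.cast_le.2 <| Finset.card_le_card (Finset.compl_subset_compl.2 hAU)
  have hN0 : 0 ≤ N := Nat.cast_nonneg _
  have hp0 : 0 ≤ p := sub_nonneg.2 (pow_le_one₀ (by positivity) ((div_le_one hA').2 hNA))
  have hp1 : p ≤ 1 := sub_le_self _ (by positivity)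
  have hn : 0 < n := v.pos
  have hsum := sum_exploredAs (k := k) v r A U hAU hn hA (Real.exp (-ξ))
  rw [← hE, ← hN, ← hp] at hsum
  have hlow : ((E.filter fun f => (hitCount U f : ℝ) < (1 - ξ) * (N * p)).card : ℝ) *
      Real.exp (-(ξ * ((1 - ξ) * (N * p)))) ≤ ∑ f ∈ E, Real.exp (-ξ) ^ hitCount U f := by
    rw [← nsmul_eq_mul, ← Finset.sum_const]
    refine (Finset.sum_le_sum fun f hf => ?_).trans
      (Finset.sum_le_sum_of_subset_of_nonneg (Finset.filter_subset _ _)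
        fun f _ _ => by positivity)
    rw [← Real.exp_nat_mul]
    apply Real.exp_le_exp.2
    have := (Finset.mem_filter.1 hf).2
    nlinarith
  have hup : (1 - (1 - Real.exp (-ξ)) * p) ^ Uᶜ.card ≤
      Real.exp (-(N * ((1 - Real.exp (-ξ)) * p))) := by
    have hx : 0 ≤ 1 - Real.exp (-ξ) := by
      have := Real.exp_le_one_iff.2 (neg_nonpos.2 hξ); linarith
    have hx1 : 1 - Real.exp (-ξ) ≤ 1 := by linarith [Real.exp_pos (-ξ)]
    have h0 : 0 ≤ 1 - (1 - Real.exp (-ξ)) * p := by nlinarith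
    calc _ ≤ Real.exp (-((1 - Real.exp (-ξ)) * p)) ^ Uᶜ.card :=
          pow_le_pow_left₀ h0 (by
            have := Real.add_one_le_exp (-((1 - Real.exp (-ξ)) * p)); linarith) _
      _ = _ := by rw [← Real.exp_nat_mul, hN]; ring_nf
  have hexp : Real.exp (-(N * ((1 - Real.exp (-ξ)) * p))) ≤
      Real.exp (-(ξ ^ 2 * y / 2)) * Real.exp (-(ξ * ((1 - ξ) * (N * p)))) := by
    rw [← Real.exp_add]
    apply Real.exp_le_exp.2
    have h1 := exp_neg_le_quadratic hξ
    have hNp : 0 ≤ N * p := mul_nonneg hN0 hp0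
    have h2 := mul_le_mul_of_nonneg_right h1 hNp
    have h3 := mul_le_mul_of_nonneg_left hy (sq_nonneg ξ)
    nlinarith
  have hfin : ((E.filter fun f => (hitCount U f : ℝ) < (1 - ξ) * (N * p)).card : ℝ) *
      Real.exp (-(ξ * ((1 - ξ) * (N * p)))) ≤
      Real.exp (-(ξ ^ 2 * y / 2)) * E.card * Real.exp (-(ξ * ((1 - ξ) * (N * p)))) := by
    calc _ ≤ _ := hlow
      _ = _ := hsum
      _ ≤ E.card * (Real.exp (-(ξ ^ 2 * y / 2)) * Real.exp (-(ξ * ((1 - ξ) * (N * p))))) :=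
          mul_le_mul_of_nonneg_left (hup.trans hexp) (Nat.cast_nonneg _)
      _ = _ := by ring
  exact le_of_mul_le_mul_right hfin (Real.exp_pos _)

/-- A generation of the in-ball is unlikely to be much smaller than its conditional mean. -/
lemma prob_slow_growth_le (v : Fin n) (r : ℕ) {ξ y : ℝ} (hξ : 0 ≤ ξ) :
    prob n k (fun f => (0 < outCount f v r ∧
        y ≤ outCount f v (r + 1) *
          (1 - ((outCount f v (r + 1) : ℝ) / outCount f v r) ^ k)) ∧
        (outCount f v (r + 1) : ℝ) - outCount f v (r + 2) <
          (1 - ξ) * (outCount f v (r + 1) *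
            (1 - ((outCount f v (r + 1) : ℝ) / outCount f v r) ^ k))) ≤
      Real.exp (-(ξ ^ 2 * y / 2)) := by
  refine (prob_and_le_of_explored v r (fun A U => 0 < Aᶜ.card ∧
    y ≤ Uᶜ.card * (1 - ((Uᶜ.card : ℝ) / Aᶜ.card) ^ k)) _ (Real.exp (-(ξ ^ 2 * y / 2))) ?_).trans
      (mul_le_of_le_one_right (Real.exp_pos _).le (prob_le_one _))
  rintro A U ⟨hA, hy⟩ hAU
  refine le_trans (Nat.cast_le.2 ?_) (card_hitCount_lt_le (k := k) v r A U hAU hA hξ hy)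
  refine Finset.card_le_card fun f hf => ?_
  rw [Finset.mem_filter] at hf ⊢
  refine ⟨hf.1, ?_⟩
  have hA := (Finset.mem_filter.1 hf.1).2.1
  have hU := (Finset.mem_filter.1 hf.1).2.2
  have h : (hitCount (inBall f v (r + 1)) f : ℝ) = outCount f v (r + 1) - outCount f v (r + 2) :=
    eq_sub_of_add_eq (by exact_mod_cast hitCount_add_outCount f v r)
  have h2 := hf.2
  rw [← h] at h2
  simpa only [outCount, hA, hU] using h2

/-- A bounded nonempty generation of the in-ball is the last one with probability bounded below. -/
lemma le_prob_extinct (v : Fin n) (r M : ℕ) :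
    Real.exp (-(2 * k * M)) * prob n k (fun f => (2 * M ≤ outCount f v r ∧
        outCount f v (r + 1) < outCount f v r) ∧ outCount f v r ≤ outCount f v (r + 1) + M) ≤
      prob n k (fun f => ((2 * M ≤ outCount f v r ∧ outCount f v (r + 1) < outCount f v r) ∧
        outCount f v r ≤ outCount f v (r + 1) + M) ∧
        outCount f v (r + 2) = outCount f v (r + 1)) := by
  refine le_prob_and_of_explored v r (fun A U => (2 * M ≤ Aᶜ.card ∧ Uᶜ.card < Aᶜ.card) ∧
    Aᶜ.card ≤ Uᶜ.card + M) _ _ ?_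
  rintro A U ⟨⟨hM, hUA⟩, hU⟩ hAU
  have hA : 0 < Aᶜ.card := by omega
  have hs := sum_exploredAs (k := k) v r A U hAU v.pos hA 0
  have e : (((exploredAs k v r A U).filter fun f => hitCount U f = 0).card : ℝ) ≤
      ((exploredAs k v r A U).filter fun f =>
        outCount f v (r + 2) = outCount f v (r + 1)).card := by
    refine Nat.cast_le.2 (Finset.card_le_card fun f hf => ?_)
    rw [Finset.mem_filter] at hf ⊢
    refine ⟨hf.1, ?_⟩
    have h0 := hf.2
    replace hf := hf.1
    have hU := (Finset.mem_filter.1 hf).2.2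
    have h := hitCount_add_outCount f v r
    rw [hU] at h
    omega
  have hA' : (0 : ℝ) < Aᶜ.card := by exact_mod_cast hA
  have hNA : (Uᶜ.card : ℝ) ≤ Aᶜ.card := by
    exact_mod_cast Finset.card_le_card (Finset.compl_subset_compl.2 hAU)
  have hM' : 2 * (M : ℝ) ≤ Aᶜ.card := by exact_mod_cast hM
  have hU' : (Aᶜ.card : ℝ) ≤ Uᶜ.card + M := by exact_mod_cast hU
  simp only [sub_zero, one_mul, sub_sub_cancel, zero_pow_eq, Finset.sum_ite, Finset.sum_const,
    nsmul_eq_mul, mul_one, mul_zero, add_zero] at hs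
  refine le_trans ?_ (((ge_of_eq hs).trans e).trans_eq (by congr!))
  rw [mul_comm]
  refine mul_le_mul_of_nonneg_left ?_ (Nat.cast_nonneg _)
  have hx : Real.exp (-(2 * (M / Aᶜ.card))) ≤ (Uᶜ.card : ℝ) / Aᶜ.card := by
    refine (exp_neg_two_mul_le_one_sub (by positivity) ?_).trans ?_
    · rw [div_le_div_iff₀ hA' two_pos]; linarith
    · rw [le_div_iff₀ hA', sub_mul, div_mul_cancel₀ _ hA'.ne']; linarith
  calc Real.exp (-(2 * k * M)) ≤ Real.exp (-(2 * (M / Aᶜ.card))) ^ (k * Uᶜ.card) := by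
        rw [← Real.exp_nat_mul]
        apply Real.exp_le_exp.2
        push_cast
        have h1 : (Uᶜ.card : ℝ) * (M / Aᶜ.card) ≤ M := by
          rw [← mul_div_assoc, div_le_iff₀ hA', mul_comm]
          exact mul_le_mul_of_nonneg_left hNA (Nat.cast_nonneg _)
        have := mul_le_mul_of_nonneg_left h1 (Nat.cast_nonneg (α := ℝ) k)
        nlinarith
    _ ≤ ((Uᶜ.card : ℝ) / Aᶜ.card) ^ (k * Uᶜ.card) :=
        pow_le_pow_left₀ (Real.exp_pos _).le hx _
    _ = _ := pow_mul _ _ _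

end OneGeneration

section Growth

variable {n k : ℕ}

/-- If no generation after a frontier of size `M` is slow, the in-ball soon covers most vertices. -/
lemma exists_slow_growth (f : Fin n × Fin k → Fin n) (v : Fin n) (r M J s : ℕ) {ξ τ : ℝ}
    (hk : 0 < k) (hξ0 : 0 < ξ) (hξ1 : ξ < 1) (hκ : 1 ≤ (1 - ξ) ^ 2 * k) (hτ : 0 < τ)
    (hs : (1 - ξ / k) ^ s < τ) (hJ : (n : ℝ) ≤ M * ((1 - ξ) ^ 2 * k) ^ J)
    (hM : outCount f v (r + 1) + M ≤ outCount f v r)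
    (hout : τ * n ≤ outCount f v (r + (J + s) + 1)) :
    ∃ j < J + s, (0 < outCount f v (r + j) ∧
        τ * n * min (M * ((1 - ξ) ^ 2 * k) ^ j / n) (ξ / k) ≤ outCount f v (r + j + 1) *
          (1 - ((outCount f v (r + j + 1) : ℝ) / outCount f v (r + j)) ^ k)) ∧
        (outCount f v (r + j + 1) : ℝ) - outCount f v (r + j + 2) <
          (1 - ξ) * (outCount f v (r + j + 1) *
            (1 - ((outCount f v (r + j + 1) : ℝ) / outCount f v (r + j)) ^ k)) := by
  by_contra! hcon
  set κ : ℝ := (1 - ξ) ^ 2 * k with hκdef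
  set a : ℕ → ℝ := fun j => (outCount f v (r + j) : ℝ) with ha
  have hn : (0 : ℝ) < n := by exact_mod_cast v.pos
  have hk' : (0 : ℝ) < k := by exact_mod_cast hk
  have hk1 : (1 : ℝ) ≤ k := by exact_mod_cast hk
  have hanti : Antitone a := fun i j hij =>
    Nat.cast_le.2 (outCount_antitone f v (by omega))
  have hlow : ∀ j ≤ J + s + 1, τ * n ≤ a j := fun j hj => hout.trans (hanti hj)
  have hpos : ∀ j ≤ J + s + 1, 0 < a j := fun j hj => lt_of_lt_of_le (by positivity) (hlow j hj)
  have hale : a 0 ≤ n := Nat.cast_le.2 (outCount_le f v _)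
  set θ : ℕ → ℝ := fun j => min (M * κ ^ j / n) (ξ / k) with hθ
  have hθ0 : ∀ j, 0 ≤ θ j := fun j => le_min (by positivity) (by positivity)
  have hq : ∀ j ≤ J + s, θ j ≤ 1 - a (j + 1) / a j := by
    intro j
    induction j with
    | zero =>
      intro _
      have h0 := hpos 0 (by omega)
      have hM' : ((outCount f v (r + 1) + M : ℕ) : ℝ) ≤ outCount f v r := Nat.cast_le.2 hM
      push_cast at hM'
      replace hM' : a 1 + M ≤ a 0 := hM'
      refine (min_le_left _ _).trans ?_
      rw [pow_zero, mul_one, one_sub_div h0.ne', div_le_div_iff₀ hn h0]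
      have hM0 : (0 : ℝ) ≤ M := Nat.cast_nonneg _
      calc (M : ℝ) * a 0 ≤ M * n := mul_le_mul_of_nonneg_left hale hM0
        _ ≤ (a 0 - a (0 + 1)) * n := mul_le_mul_of_nonneg_right (by simp; linarith) hn.le
    | succ j ih =>
      intro hj
      have h := ih (by omega)
      have p0 := hpos j (by omega)
      have p1 := hpos (j + 1) (by omega)
      have hr1 : a (j + 1) / a j ≤ 1 := (div_le_one p0).2 (hanti (Nat.le_succ j))
      have hr0 : 0 ≤ a (j + 1) / a j := by positivity
      have hpow : (a (j + 1) / a j) ^ k ≤ a (j + 1) / a j :=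
        pow_le_of_le_one hr0 hr1 hk.ne'
      have hst := hcon j (by omega) ⟨Nat.cast_pos.1 p0, by
        refine mul_le_mul (hlow (j + 1) (by omega)) ?_ (hθ0 j) p1.le
        exact h.trans (sub_le_sub_left hpow 1)⟩
      have hg := growth_step (k := k) hξ1 (hθ0 j) h (by linarith) (by
        calc k * θ j ≤ k * (ξ / k) := mul_le_mul_of_nonneg_left (min_le_right _ _) hk'.le
          _ = ξ := by field_simp)
      rw [sub_sub_cancel] at hg
      have hgoal : κ * θ j ≤ 1 - a (j + 2) / a (j + 1) := by
        rw [one_sub_div p1.ne', le_div_iff₀ p1]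
        calc κ * θ j * a (j + 1) ≤
              ((1 - ξ) * (1 - (a (j + 1) / a j) ^ k)) * a (j + 1) :=
              mul_le_mul_of_nonneg_right hg p1.le
          _ = (1 - ξ) * (a (j + 1) * (1 - (a (j + 1) / a j) ^ k)) := by ring
          _ ≤ _ := hst
      refine le_trans ?_ hgoal
      simp only [hθ]
      rw [mul_min_of_nonneg _ _ (by linarith)]
      refine min_le_min (le_of_eq (by ring)) ?_
      exact le_mul_of_one_le_left (by positivity) hκ
  have hq0 : ξ / k ≤ 1 := (div_le_one hk').2 (by linarith)
  have hdecay : ∀ i ≤ s, a (J + i) ≤ n * (1 - ξ / k) ^ i := by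
    intro i
    induction i with
    | zero => intro _; simpa using (hanti (Nat.zero_le J)).trans hale
    | succ i ih =>
      intro hi
      have p0 := hpos (J + i) (by omega)
      have h := hq (J + i) (by omega)
      have hθe : θ (J + i) = ξ / k := by
        refine min_eq_right (hq0.trans ?_)
        rw [one_le_div hn, pow_add, ← mul_assoc]
        exact hJ.trans (le_mul_of_one_le_right (by positivity) (one_le_pow₀ hκ))
      rw [hθe, one_sub_div p0.ne', le_div_iff₀ p0] at h
      calc a (J + (i + 1)) ≤ (1 - ξ / k) * a (J + i) := by
            rw [← add_assoc]; linarith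
        _ ≤ (1 - ξ / k) * (n * (1 - ξ / k) ^ i) :=
            mul_le_mul_of_nonneg_left (ih (by omega)) (by linarith)
        _ = _ := by ring
  have h1 := hdecay s le_rfl
  have h2 := hlow (J + s) (by omega)
  have h3 := mul_lt_mul_of_pos_left hs hn
  linarith

/-- A large frontier leads, up to a small probability, to an almost covering in-ball. -/
lemma prob_large_frontier_le (v : Fin n) (r M J s : ℕ) {ξ τ : ℝ}
    (hk : 0 < k) (hM : 0 < M) (hξ0 : 0 < ξ) (hξ1 : ξ < 1) (hκ : 1 < (1 - ξ) ^ 2 * k) (hτ : 0 < τ)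
    (hs : (1 - ξ / k) ^ s < τ) (hJ : (n : ℝ) ≤ M * ((1 - ξ) ^ 2 * k) ^ J) :
    prob n k (fun f => outCount f v (r + 1) + M ≤ outCount f v r ∧
      τ * n ≤ outCount f v (r + (J + s) + 1)) ≤
      2 / (ξ ^ 2 * τ) * ((1 - ((1 - ξ) ^ 2 * k)⁻¹)⁻¹ / M + (J + s : ℕ) * (k / (ξ * n))) := by
  refine (prob_mono fun f hf => exists_slow_growth f v r M J s hk hξ0 hξ1 hκ.le hτ hs hJ
    hf.1 hf.2).trans ((prob_exists_lt_le _ _).trans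
      ((Finset.sum_le_sum fun j _ => prob_slow_growth_le v (r + j) hξ0.le).trans ?_))
  set κ : ℝ := (1 - ξ) ^ 2 * k with hκdef
  have hn : (0 : ℝ) < n := by exact_mod_cast v.pos
  have hk' : (0 : ℝ) < k := by exact_mod_cast hk
  have hM' : (0 : ℝ) < M := by exact_mod_cast hM
  have hκ0 : 0 < κ := by linarith
  have hterm : ∀ j, Real.exp (-(ξ ^ 2 * (τ * n * min (M * κ ^ j / n) (ξ / k)) / 2)) ≤
      2 / (ξ ^ 2 * τ) * (κ⁻¹ ^ j / M + k / (ξ * n)) := by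
    intro j
    have hmin : 0 < min (M * κ ^ j / n) (ξ / k) := lt_min (by positivity) (by positivity)
    have hinv : (min (M * κ ^ j / n) (ξ / k))⁻¹ ≤ (M * κ ^ j / n)⁻¹ + (ξ / k)⁻¹ := by
      have i1 : 0 < (M * κ ^ j / n)⁻¹ := by positivity
      have i2 : 0 < (ξ / k)⁻¹ := by positivity
      rcases min_choice (M * κ ^ j / n) (ξ / k) with h | h <;> rw [h] <;> linarith
    refine (exp_neg_le_inv (by positivity)).trans ?_
    calc (ξ ^ 2 * (τ * n * min (M * κ ^ j / n) (ξ / k)) / 2)⁻¹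
        = 2 / (ξ ^ 2 * τ * n) * (min (M * κ ^ j / n) (ξ / k))⁻¹ := by
          field_simp
      _ ≤ 2 / (ξ ^ 2 * τ * n) * ((M * κ ^ j / n)⁻¹ + (ξ / k)⁻¹) := by gcongr
      _ = _ := by rw [inv_pow]; field_simp
  refine (Finset.sum_le_sum fun j _ => hterm j).trans ?_
  rw [← Finset.mul_sum, Finset.sum_add_distrib, ← Finset.sum_div, Finset.sum_const,
    Finset.card_range, nsmul_eq_mul]
  gcongr
  have hi : κ⁻¹ < 1 := inv_lt_one_of_one_lt₀ hκ
  rw [← tsum_geometric_of_lt_one (by positivity) hi]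
  exact (summable_geometric_of_lt_one (by positivity) hi).sum_le_tsum _ fun _ _ => by positivity

/-- Some generation among the first `R` is unlikely to be nonempty and small. -/
lemma exists_prob_small_frontier_le (v : Fin n) (M R : ℕ) (hR : 0 < R) :
    ∃ r < R, prob n k (fun f => (2 * M ≤ outCount f v r ∧
      outCount f v (r + 1) < outCount f v r) ∧ outCount f v r ≤ outCount f v (r + 1) + M) ≤
      Real.exp (2 * k * M) / R := by
  by_contra! hcon
  have hR' : (0 : ℝ) < R := by exact_mod_cast hR
  have h1 := sum_prob_le_one (n := n) (k := k) (fun r f => ((2 * M ≤ outCount f v r ∧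
    outCount f v (r + 1) < outCount f v r) ∧ outCount f v r ≤ outCount f v (r + 1) + M) ∧
      outCount f v (r + 2) = outCount f v (r + 1)) R (by
    rintro i j f hij ⟨-, hi⟩ ⟨⟨⟨-, hj⟩, -⟩, -⟩
    have e : ∀ t, outCount f v (i + 1 + t) = outCount f v (i + 1) := fun t => by
      unfold outCount
      rw [inBall_eq_of_outCount_eq hi t]
    obtain ⟨t, rfl⟩ := Nat.exists_eq_add_of_lt hij
    have e1 := e t
    have e2 := e (t + 1)
    rw [show i + 1 + t = i + t + 1 by ring] at e1
    rw [show i + 1 + (t + 1) = i + t + 1 + 1 by ring] at e2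
    omega)
  have h2 : ∑ _r ∈ Finset.range R, (R : ℝ)⁻¹ < _ :=
    Finset.sum_lt_sum_of_nonempty (Finset.nonempty_range_iff.2 hR.ne') fun r hr => by
      refine lt_of_lt_of_le ?_ (le_prob_extinct (n := n) (k := k) v r M)
      have h := hcon r (Finset.mem_range.1 hr)
      have := mul_lt_mul_of_pos_left h (Real.exp_pos (-(2 * k * M)))
      refine lt_of_le_of_lt (le_of_eq ?_) this
      rw [mul_div_assoc', ← Real.exp_add]
      simp
  rw [Finset.sum_const, Finset.card_range, nsmul_eq_mul, mul_inv_cancel₀ hR'.ne'] at h2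
  linarith

end Growth

section Prob2

variable {n k : ℕ}

lemma prob2_eq_sum_left (P : (Fin n × Fin k → Fin n) → Fin n → Fin n → Prop) :
    prob2 n k P = (∑ u, ∑ f, ((Finset.univ.filter fun v => P f u v).card : ℝ)) /
      (n * (n * Fintype.card (Fin n × Fin k → Fin n))) := by
  unfold prob2
  congr 1
  · rw [Finset.sum_comm]
    simp only [Finset.card_filter, Fintype.sum_prod_type]
    push_cast
    rfl
  · simp only [Fintype.card_prod, Fintype.card_fin]
    push_cast
    ring

lemma prob2_eq_sum_right (P : (Fin n × Fin k → Fin n) → Fin n → Fin n → Prop) :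
    prob2 n k P = (∑ v, ∑ f, ((Finset.univ.filter fun u => P f u v).card : ℝ)) /
      (n * (n * Fintype.card (Fin n × Fin k → Fin n))) := by
  rw [prob2_eq_sum_left]
  congr 1
  simp only [Finset.card_filter]
  push_cast
  exact Finset.sum_comm.trans
    ((Finset.sum_congr rfl fun f _ => Finset.sum_comm).trans Finset.sum_comm)

lemma prob2_nonneg (P : (Fin n × Fin k → Fin n) → Fin n → Fin n → Prop) : 0 ≤ prob2 n k P := by
  unfold prob2; positivity

lemma prob2_mono {P Q : (Fin n × Fin k → Fin n) → Fin n → Fin n → Prop}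
    (h : ∀ f u v, P f u v → Q f u v) : prob2 n k P ≤ prob2 n k Q := by
  unfold prob2
  gcongr with x
  exact h _ _ _

lemma prob2_or_le (P Q : (Fin n × Fin k → Fin n) → Fin n → Fin n → Prop) :
    prob2 n k (fun f u v => P f u v ∨ Q f u v) ≤ prob2 n k P + prob2 n k Q := by
  unfold prob2
  rw [← add_div]
  gcongr
  rw [← Nat.cast_add]
  exact Nat.cast_le.2 ((Finset.card_le_card fun f hf => by simpa using hf).trans
    (Finset.card_union_le _ _))

lemma prob2_le_of_forall_right (hn : 0 < n)
    (P : (Fin n × Fin k → Fin n) → Fin n → Fin n → Prop) (b : ℝ)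
    (h : ∀ v, ∑ f, ((Finset.univ.filter fun u => P f u v).card : ℝ) ≤
      b * (n * Fintype.card (Fin n × Fin k → Fin n))) : prob2 n k P ≤ b := by
  have : Nonempty (Fin n) := ⟨⟨0, hn⟩⟩
  have hc : (0 : ℝ) < Fintype.card (Fin n × Fin k → Fin n) := by
    exact_mod_cast Fintype.card_pos
  have hn' : (0 : ℝ) < n := by exact_mod_cast hn
  rw [prob2_eq_sum_right, div_le_iff₀ (by positivity)]
  refine (Finset.sum_le_sum fun v _ => h v).trans (le_of_eq ?_)
  simp
  ring

lemma prob_eq_card (P : (Fin n × Fin k → Fin n) → Prop) [DecidablePred P] :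
    prob n k P = ((Finset.univ.filter P).card : ℝ) / Fintype.card (Fin n × Fin k → Fin n) := by
  unfold prob; congr!

lemma sum_indicator_eq_prob (P : (Fin n × Fin k → Fin n) → Prop) [DecidablePred P] :
    ∑ f, (if P f then (1 : ℝ) else 0) =
      prob n k P * Fintype.card (Fin n × Fin k → Fin n) := by
  by_cases hc : (Fintype.card (Fin n × Fin k → Fin n) : ℝ) = 0
  · have : IsEmpty (Fin n × Fin k → Fin n) := by
      rw [← Fintype.card_eq_zero_iff]; exact_mod_cast hc
    simp
  · rw [prob_eq_card P, div_mul_cancel₀ _ hc]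
    simp

/-- Few pairs of vertices are at distance less than `m`. -/
lemma prob2_near_le (hn : 0 < n) (hk : 2 ≤ k) (m : ℕ) :
    prob2 n k (fun f u v => ∃ h : ℕ, pathDist f u v = (h : ℕ∞) ∧ h < m) ≤ (k : ℝ) ^ m / n := by
  have : Nonempty (Fin n) := ⟨⟨0, hn⟩⟩
  have hc : (0 : ℝ) < Fintype.card (Fin n × Fin k → Fin n) := by
    exact_mod_cast Fintype.card_pos
  have hn' : (0 : ℝ) < n := by exact_mod_cast hn
  have hgeom : ∀ m, ∑ j ∈ Finset.range m, k ^ j ≤ k ^ m := fun m => by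
    induction m with
    | zero => simp
    | succ m ih =>
      rw [Finset.sum_range_succ, pow_succ]
      have := Nat.mul_le_mul_left (k ^ m) hk
      omega
  have hcard : ∀ (f : Fin n × Fin k → Fin n) (u : Fin n),
      ((Finset.univ.filter fun v => ∃ h : ℕ, pathDist f u v = (h : ℕ∞) ∧ h < m).card : ℝ) ≤
        (k : ℝ) ^ m := by
    intro f u
    have h : (Finset.univ.filter fun v => ∃ h : ℕ, pathDist f u v = (h : ℕ∞) ∧ h < m) ⊆
        (Finset.range m).biUnion fun j => Finset.univ.filter fun v => HasPath f j u v := by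
      intro v hv
      obtain ⟨j, hj, hm⟩ := (Finset.mem_filter.1 hv).2
      simp only [Finset.mem_biUnion, Finset.mem_range, Finset.mem_filter, Finset.mem_univ, true_and]
      exact ⟨j, hm, hasPath_of_pathDist_eq hj⟩
    exact_mod_cast (Finset.card_le_card h).trans (Finset.card_biUnion_le.trans
      ((Finset.sum_le_sum fun j _ => card_hasPath_le f j u).trans (hgeom m)))
  rw [prob2_eq_sum_left, div_le_div_iff₀ (by positivity) hn']
  calc _ ≤ (∑ _u : Fin n, ∑ _f : Fin n × Fin k → Fin n, (k : ℝ) ^ m) * n := by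
        gcongr with u _ f _
        exact hcard f u
    _ = _ := by simp; ring

/-- Few pairs of vertices are at finite distance at least `R + J + s + 1`. -/
lemma prob2_far_le (M R J s : ℕ) {ξ τ : ℝ}
    (hn : 0 < n) (hk : 0 < k) (hM : 0 < M) (hR : 0 < R) (hξ0 : 0 < ξ) (hξ1 : ξ < 1)
    (hκ : 1 < (1 - ξ) ^ 2 * k) (hτ : 0 < τ)
    (hs : (1 - ξ / k) ^ s < τ) (hJ : (n : ℝ) ≤ M * ((1 - ξ) ^ 2 * k) ^ J)
    (hMn : 2 * (M : ℝ) ≤ τ * n) :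
    prob2 n k (fun f u v => ∃ h : ℕ, pathDist f u v = (h : ℕ∞) ∧ R + (J + s) + 1 ≤ h) ≤
      τ + Real.exp (2 * k * M) / R +
      2 / (ξ ^ 2 * τ) * ((1 - ((1 - ξ) ^ 2 * k)⁻¹)⁻¹ / M + (J + s : ℕ) * (k / (ξ * n))) := by
  refine prob2_le_of_forall_right hn _ _ fun v => ?_
  obtain ⟨r, hr, hsmall⟩ := exists_prob_small_frontier_le (k := k) v M R hR
  have hlarge := prob_large_frontier_le (k := k) v r M J s hk hM hξ0 hξ1 hκ hτ hs hJ
  have hn' : (0 : ℝ) < n := by exact_mod_cast hn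
  set P : (Fin n × Fin k → Fin n) → Prop := fun f => (2 * M ≤ outCount f v r ∧
      outCount f v (r + 1) < outCount f v r) ∧ outCount f v r ≤ outCount f v (r + 1) + M with hP
  set Q : (Fin n × Fin k → Fin n) → Prop := fun f => outCount f v (r + 1) + M ≤ outCount f v r ∧
      τ * n ≤ outCount f v (r + (J + s) + 1) with hQ
  have hpt : ∀ f : Fin n × Fin k → Fin n, ((Finset.univ.filter fun u =>
      ∃ h : ℕ, pathDist f u v = (h : ℕ∞) ∧ R + (J + s) + 1 ≤ h).card : ℝ) ≤
      τ * n + n * (if P f then 1 else 0) + n * (if Q f then 1 else 0) := by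
    intro f
    have hsub : (Finset.univ.filter fun u => ∃ h : ℕ, pathDist f u v = (h : ℕ∞) ∧
        R + (J + s) + 1 ≤ h) ⊆ (inBall f v (R + (J + s) + 1))ᶜ := by
      intro u hu
      obtain ⟨h, hd, hh⟩ := (Finset.mem_filter.1 hu).2
      rw [Finset.mem_compl, mem_inBall_iff]
      rintro ⟨m, hm, hp⟩
      have := pathDist_le_of_hasPath hp
      rw [hd, Nat.cast_le] at this
      omega
    have hcard : ((Finset.univ.filter fun u =>
        ∃ h : ℕ, pathDist f u v = (h : ℕ∞) ∧ R + (J + s) + 1 ≤ h).card : ℝ) ≤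
        outCount f v (R + (J + s) + 1) := Nat.cast_le.2 (Finset.card_le_card hsub)
    have hcn : (outCount f v (R + (J + s) + 1) : ℝ) ≤ n := Nat.cast_le.2 (outCount_le f v _)
    have hτn : 0 < τ * n := by positivity
    by_cases hPf : P f
    · rw [if_pos hPf]
      split_ifs <;> linarith
    by_cases hQf : Q f
    · rw [if_pos hQf]
      split_ifs
      linarith
    rw [if_neg hPf, if_neg hQf]
    have a1 : outCount f v (R + (J + s) + 1) ≤ outCount f v (r + (J + s) + 1) :=
      outCount_antitone f v (by omega)
    have a2 : outCount f v (R + (J + s) + 1) ≤ outCount f v r := outCount_antitone f v (by omega)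
    have a3 : outCount f v (r + 1) ≤ outCount f v r := outCount_antitone f v (by omega)
    by_cases h1 : outCount f v r < 2 * M
    · have h1' : (outCount f v (R + (J + s) + 1) : ℝ) ≤ 2 * M := by
        exact_mod_cast a2.trans h1.le
      linarith
    by_cases h2 : outCount f v (r + 1) < outCount f v r
    · have h3 : outCount f v (r + 1) + M ≤ outCount f v r := by
        by_contra h3
        exact hPf ⟨⟨by omega, h2⟩, by omega⟩
      have h4 : (outCount f v (r + (J + s) + 1) : ℝ) < τ * n := by
        by_contra! h4
        exact hQf ⟨h3, h4⟩
      have a1' : (outCount f v (R + (J + s) + 1) : ℝ) ≤ outCount f v (r + (J + s) + 1) := by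
        exact_mod_cast a1
      linarith
    · have h3 : outCount f v (r + 1) = outCount f v r := by omega
      have hempty : (Finset.univ.filter fun u =>
          ∃ h : ℕ, pathDist f u v = (h : ℕ∞) ∧ R + (J + s) + 1 ≤ h) = ∅ := by
        refine Finset.filter_eq_empty_iff.2 ?_
        rintro u - ⟨h, hd, hh⟩
        have hu : u ∈ inBall f v (r + (h + 1)) :=
          mem_inBall_iff.2 ⟨h, by omega, hasPath_of_pathDist_eq hd⟩
        rw [inBall_eq_of_outCount_eq h3, mem_inBall_iff] at hu
        obtain ⟨m, hm, hp⟩ := hu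
        have := pathDist_le_of_hasPath hp
        rw [hd, Nat.cast_le] at this
        omega
      rw [hempty]
      simp only [Finset.card_empty, Nat.cast_zero]
      linarith
  refine (Finset.sum_le_sum fun f _ => hpt f).trans ?_
  rw [Finset.sum_add_distrib, Finset.sum_add_distrib, Finset.sum_const, ← Finset.mul_sum,
    ← Finset.mul_sum, sum_indicator_eq_prob, sum_indicator_eq_prob, nsmul_eq_mul, Finset.card_univ]
  have hc : (0 : ℝ) ≤ n * Fintype.card (Fin n × Fin k → Fin n) := by positivity
  have b1 := mul_le_mul_of_nonneg_right hsmall hc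
  have b2 := mul_le_mul_of_nonneg_right hlarge hc
  rw [add_mul, add_mul]
  linarith

end Prob2

section Reachability

variable {n k : ℕ}

lemma pathDist_ne_top_iff {f : Fin n × Fin k → Fin n} {u v : Fin n} :
    pathDist f u v ≠ ⊤ ↔ ∃ m, HasPath f m u v := by
  constructor
  · intro h
    obtain ⟨m, hm⟩ := ENat.ne_top_iff_exists.1 h
    exact ⟨m, hasPath_of_pathDist_eq hm.symm⟩
  · rintro ⟨m, hp⟩
    exact ne_top_of_le_ne_top (ENat.natCast_ne_top m) (pathDist_le_of_hasPath hp)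

lemma hasPath_append {f : Fin n × Fin k → Fin n} {m : ℕ} {u v : Fin n}
    (h : HasPath f m u v) (i : Fin k) : HasPath f (m + 1) u (f (v, i)) := by
  induction m generalizing u with
  | zero =>
    rw [hasPath_zero] at h
    subst h
    exact (hasPath_succ _ _ _ _).2 ⟨i, (hasPath_zero _ _ _).2 rfl⟩
  | succ m ih =>
    obtain ⟨j, hj⟩ := (hasPath_succ _ _ _ _).1 h
    exact (hasPath_succ _ _ _ _).2 ⟨j, ih hj⟩

lemma prob_closed (S : Finset (Fin n)) (hn : 0 < n) :
    prob n k (fun f => ∀ x, x.1 ∈ S → f x ∈ S) = ((S.card : ℝ) / n) ^ (k * S.card) := by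
  have e : (Finset.univ.filter fun f : Fin n × Fin k → Fin n => ∀ x, x.1 ∈ S → f x ∈ S) =
      Fintype.piFinset fun x : Fin n × Fin k => if x.1 ∈ S then S else Finset.univ := by
    ext f
    simp only [Finset.mem_filter, Finset.mem_univ, true_and, Fintype.mem_piFinset]
    refine forall_congr' fun x => ?_
    by_cases h : x.1 ∈ S <;> simp [h]
  have hn' : (0 : ℝ) < n := by exact_mod_cast hn
  have hcard : (Fintype.card (Fin n × Fin k → Fin n) : ℝ) = ∏ _x : Fin n × Fin k, (n : ℝ) := by
    simp [Fintype.card_pi]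
  rw [prob_eq_card, e, Fintype.card_piFinset, hcard]
  push_cast
  rw [← Finset.prod_div_distrib, Fintype.prod_prod_type]
  have : ∀ u : Fin n, ∏ i : Fin k, (((if (u, i).1 ∈ S then S else Finset.univ).card : ℝ) / n) =
      if u ∈ S then ((S.card : ℝ) / n) ^ k else 1 := by
    intro u
    by_cases h : u ∈ S <;> simp [h, hn'.ne', div_pow]
  rw [Finset.prod_congr rfl fun u _ => this u]
  rw [Finset.prod_ite_mem]
  simp [pow_mul]

lemma choose_mul_pow_le (s : ℕ) (hk : 2 ≤ k) (hn : 0 < n) (hs : 12 * s ≤ n) :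
    (n.choose s : ℝ) * ((s : ℝ) / n) ^ (k * s) ≤ (1 / 4) ^ s := by
  have hn' : (0 : ℝ) < n := by exact_mod_cast hn
  have hs' : 12 * (s : ℝ) ≤ n := by exact_mod_cast hs
  have hsn : (s : ℝ) / n ≤ 1 / 12 := by rw [div_le_div_iff₀ hn' (by norm_num)]; linarith
  have h0 : (0 : ℝ) ≤ (s : ℝ) / n := by positivity
  have h1 : ((s : ℝ) / n) ^ (k * s) ≤ ((s : ℝ) / n) ^ (2 * s) :=
    pow_le_pow_of_le_one h0 (by linarith) (Nat.mul_le_mul_right s hk)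
  have h2 : (n.choose s : ℝ) ≤ (n : ℝ) ^ s / s.factorial := Nat.choose_le_pow_div s n
  have h3 : (s : ℝ) ^ s / s.factorial ≤ Real.exp s := Real.pow_div_factorial_le_exp s (by positivity) s
  have h4 : Real.exp s ≤ 3 ^ s := by
    rw [← mul_one (s : ℝ), Real.exp_nat_mul]
    exact pow_le_pow_left₀ (Real.exp_pos _).le (by linarith [Real.exp_one_lt_d9]) _
  calc (n.choose s : ℝ) * ((s : ℝ) / n) ^ (k * s)
      ≤ ((n : ℝ) ^ s / s.factorial) * ((s : ℝ) / n) ^ (2 * s) := by gcongr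
    _ = ((s : ℝ) ^ s / s.factorial) * ((s : ℝ) / n) ^ s := by
        rw [two_mul, pow_add, div_pow]; field_simp
    _ ≤ 3 ^ s * (1 / 12) ^ s := by gcongr; exact h3.trans h4
    _ = (1 / 4) ^ s := by rw [← mul_pow]; norm_num

lemma prob_exists_finset_le {ι : Type*} (T : Finset ι)
    (P : ι → (Fin n × Fin k → Fin n) → Prop) :
    prob n k (fun f => ∃ S ∈ T, P S f) ≤ ∑ S ∈ T, prob n k (P S) := by
  unfold prob
  rw [← Finset.sum_div]
  gcongr
  rw [← Nat.cast_sum]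
  refine Nat.cast_le.2 ((Finset.card_le_card (t := T.biUnion fun S => Finset.univ.filter (P S))
    fun f hf => ?_).trans Finset.card_biUnion_le)
  simpa using hf

/-- Out-components of size at most `n / 12` are rare. -/
lemma prob_small_reach_le (hk : 2 ≤ k) (hn : 0 < n) (u : Fin n) :
    prob n k (fun f => 12 * (Finset.univ.filter fun v => pathDist f u v ≠ ⊤).card ≤ n) ≤
      1 / 3 := by
  set T : Finset (Finset (Fin n)) :=
    Finset.univ.filter fun S => 1 ≤ S.card ∧ 12 * S.card ≤ n with hT
  have h1 : prob n k (fun f => 12 * (Finset.univ.filter fun v => pathDist f u v ≠ ⊤).card ≤ n) ≤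
      ∑ S ∈ T, prob n k (fun f => ∀ x, x.1 ∈ S → f x ∈ S) := by
    refine (prob_mono fun f hf => ?_).trans (prob_exists_finset_le T _)
    refine ⟨Finset.univ.filter fun v => pathDist f u v ≠ ⊤, ?_, ?_⟩
    · refine Finset.mem_filter.2 ⟨Finset.mem_univ _, ?_, hf⟩
      refine Finset.card_pos.2 ⟨u, Finset.mem_filter.2 ⟨Finset.mem_univ _, ?_⟩⟩
      exact pathDist_ne_top_iff.2 ⟨0, (hasPath_zero _ _ _).2 rfl⟩
    · rintro ⟨v, i⟩ hv
      obtain ⟨m, hm⟩ := pathDist_ne_top_iff.1 (Finset.mem_filter.1 hv).2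
      exact Finset.mem_filter.2 ⟨Finset.mem_univ _, pathDist_ne_top_iff.2 ⟨_, hasPath_append hm i⟩⟩
  refine h1.trans ?_
  rw [← Finset.sum_fiberwise_of_maps_to (t := Finset.Icc 1 (n / 12)) (g := Finset.card)
    (fun S hS => by
      have := (Finset.mem_filter.1 hS).2
      rw [Finset.mem_Icc]; omega)]
  have h2 : ∀ s ∈ Finset.Icc 1 (n / 12), ∑ S ∈ T with S.card = s,
      prob n k (fun f => ∀ x, x.1 ∈ S → f x ∈ S) ≤ (1 / 4 : ℝ) ^ s := by
    intro s hs
    rw [Finset.mem_Icc] at hs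
    refine le_trans ?_ (choose_mul_pow_le (n := n) s hk hn (by omega))
    have hc : ((T.filter fun S => S.card = s).card : ℝ) ≤ n.choose s := by
      have hp := Finset.card_powersetCard s (Finset.univ : Finset (Fin n))
      rw [Finset.card_univ, Fintype.card_fin] at hp
      rw [← hp]
      refine Nat.cast_le.2 (Finset.card_le_card fun S hS => ?_)
      exact Finset.mem_powersetCard.2 ⟨Finset.subset_univ _, (Finset.mem_filter.1 hS).2⟩
    calc _ = ∑ S ∈ T with S.card = s, ((s : ℝ) / n) ^ (k * s) := by
          refine Finset.sum_congr rfl fun S hS => ?_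
          rw [prob_closed S hn, (Finset.mem_filter.1 hS).2]
      _ ≤ _ := by
          rw [Finset.sum_const, nsmul_eq_mul]
          gcongr
  refine (Finset.sum_le_sum h2).trans ?_
  have h3 : ∑ s ∈ Finset.Icc 1 (n / 12), (1 / 4 : ℝ) ^ s ≤ ∑' s : ℕ, (1 / 4 : ℝ) ^ (s + 1) := by
    have e : Finset.Icc 1 (n / 12) = (Finset.range (n / 12)).map (addRightEmbedding 1) := by
      ext x
      simp only [Finset.mem_Icc, Finset.mem_map, Finset.mem_range, addRightEmbedding_apply]
      exact ⟨fun h => ⟨x - 1, by omega, by omega⟩, by rintro ⟨a, h, rfl⟩; omega⟩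
    rw [e, Finset.sum_map]
    exact ((summable_nat_add_iff 1).2 (summable_geometric_of_lt_one (by norm_num)
      (by norm_num : (1 / 4 : ℝ) < 1))).sum_le_tsum _ fun _ _ => by positivity
  refine h3.trans (le_of_eq ?_)
  simp only [pow_succ]
  rw [tsum_mul_right, tsum_geometric_of_lt_one (by norm_num) (by norm_num)]
  norm_num

/-- Reachability of a random vertex from a random vertex has probability bounded below. -/
lemma le_prob2_reachable (hk : 2 ≤ k) (hn : 0 < n) :
    1 / 18 ≤ prob2 n k (fun f u v => pathDist f u v ≠ ⊤) := by
  have : Nonempty (Fin n) := ⟨⟨0, hn⟩⟩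
  have hc : (0 : ℝ) < Fintype.card (Fin n × Fin k → Fin n) := by
    exact_mod_cast Fintype.card_pos
  have hn' : (0 : ℝ) < n := by exact_mod_cast hn
  have hu : ∀ u : Fin n, 1 / 18 * (n * (Fintype.card (Fin n × Fin k → Fin n) : ℝ)) ≤
      ∑ f : Fin n × Fin k → Fin n,
        ((Finset.univ.filter fun v => pathDist f u v ≠ ⊤).card : ℝ) := by
    intro u
    have h1 : ∀ f : Fin n × Fin k → Fin n, (n : ℝ) / 12 * (1 - if 12 * (Finset.univ.filter
        fun v => pathDist f u v ≠ ⊤).card ≤ n then 1 else 0) ≤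
        ((Finset.univ.filter fun v => pathDist f u v ≠ ⊤).card : ℝ) := by
      intro f
      split_ifs with h
      · simp
      · have h' : (n : ℝ) ≤ 12 * (Finset.univ.filter fun v => pathDist f u v ≠ ⊤).card := by
          exact_mod_cast (not_le.1 h).le
        linarith
    refine le_trans ?_ (Finset.sum_le_sum fun f _ => h1 f)
    rw [← Finset.mul_sum, Finset.sum_sub_distrib, sum_indicator_eq_prob (fun f =>
      12 * (Finset.univ.filter fun v => pathDist f u v ≠ ⊤).card ≤ n), Finset.sum_const,
      Finset.card_univ, nsmul_eq_mul, mul_one]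
    have := mul_le_mul_of_nonneg_right (prob_small_reach_le hk hn u) (mul_nonneg hn'.le hc.le)
    linarith
  rw [prob2_eq_sum_left, le_div_iff₀ (by positivity)]
  refine le_trans (le_of_eq ?_) (Finset.sum_le_sum
    (f := fun _ => 1 / 18 * (n * (Fintype.card (Fin n × Fin k → Fin n) : ℝ)))
    fun u _ => (hu u).trans_eq (by congr!))
  simp
  ring

end Reachability

section Asymptotics

variable {k : ℕ}

lemma exp_log_mul_typical {n : ℕ} (hk : 2 ≤ k) (hn : 0 < n) :
    Real.exp (Real.log k * (Real.log n / Real.log k)) = n := by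
  have hk' : (1 : ℝ) < k := by exact_mod_cast hk
  rw [mul_div_cancel₀ _ (Real.log_pos hk').ne', Real.exp_log (by exact_mod_cast hn)]

lemma tendsto_typical_atTop (hk : 2 ≤ k) :
    Tendsto (fun n : ℕ => Real.log n / Real.log k) atTop atTop := by
  have hk' : (1 : ℝ) < k := by exact_mod_cast hk
  exact (Real.tendsto_log_atTop.comp tendsto_natCast_atTop_atTop).atTop_div_const
    (Real.log_pos hk')

lemma eventually_prob2_near_le (hk : 2 ≤ k) {ε η : ℝ} (hε0 : 0 < ε) (hε1 : ε < 1) (hη : 0 < η) :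
    ∀ᶠ n : ℕ in atTop, prob2 n k (fun f u v => ∃ h : ℕ, pathDist f u v = (h : ℕ∞) ∧
      (h : ℝ) < (1 - ε) * (Real.log n / Real.log k)) ≤ η := by
  have hk' : (1 : ℝ) < k := by exact_mod_cast hk
  have hk0 : (0 : ℝ) < k := by linarith
  have hlim : Tendsto (fun n : ℕ => (k : ℝ) * Real.exp (-(ε * Real.log n))) atTop (nhds 0) := by
    have h := (Real.tendsto_exp_neg_atTop_nhds_zero.comp ((Real.tendsto_log_atTop.comp
      tendsto_natCast_atTop_atTop).const_mul_atTop hε0)).const_mul (k : ℝ)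
    rw [mul_zero] at h
    exact h
  filter_upwards [hlim.eventually_le_const hη, eventually_gt_atTop 0] with n hn hn0
  have hn0' : (0 : ℝ) < n := by exact_mod_cast hn0
  set ℓ := Real.log n / Real.log k with hℓ
  have hℓ0 : 0 ≤ ℓ := div_nonneg (Real.log_natCast_nonneg n) (Real.log_natCast_nonneg k)
  have hexp := exp_log_mul_typical hk hn0
  rw [← hℓ] at hexp
  have hceil : (⌈(1 - ε) * ℓ⌉₊ : ℝ) ≤ (1 - ε) * ℓ + 1 :=
    (Nat.ceil_lt_add_one (mul_nonneg (by linarith) hℓ0)).le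
  refine le_trans (prob2_mono ?_) ((prob2_near_le hn0 hk ⌈(1 - ε) * ℓ⌉₊).trans (le_trans ?_ hn))
  · rintro f u v ⟨h, hd, hh⟩
    exact ⟨h, hd, Nat.lt_ceil.2 hh⟩
  · have hlog : Real.log k * ℓ = Real.log n := mul_div_cancel₀ _ (Real.log_pos hk').ne'
    rw [div_le_iff₀ hn0']
    calc (k : ℝ) ^ ⌈(1 - ε) * ℓ⌉₊ = Real.exp (⌈(1 - ε) * ℓ⌉₊ * Real.log k) := by
          rw [Real.exp_nat_mul, Real.exp_log hk0]
      _ ≤ Real.exp (((1 - ε) * ℓ + 1) * Real.log k) := by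
          have := (Real.log_pos hk').le
          gcongr
      _ = Real.exp (Real.log k + -(ε * Real.log n) + Real.log n) := by
          congr 1
          linear_combination (1 - ε) * hlog
      _ = _ := by rw [Real.exp_add, Real.exp_add, Real.exp_log hk0, Real.exp_log hn0']

lemma eventually_prob2_far_le (hk : 2 ≤ k) {ε η : ℝ} (hε : 0 < ε) (hη : 0 < η) :
    ∀ᶠ n : ℕ in atTop, prob2 n k (fun f u v => ∃ h : ℕ, pathDist f u v = (h : ℕ∞) ∧
      (1 + ε) * (Real.log n / Real.log k) ≤ h) ≤ 4 * η := by
  have hk' : (1 : ℝ) < k := by exact_mod_cast hk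
  have hk0 : (0 : ℝ) < k := by linarith
  have hlogk := Real.log_pos hk'
  set β : ℝ := (1 + ε / 2)⁻¹ with hβ
  have hβ0 : 0 < β := by positivity
  have hβ1 : β < 1 := inv_lt_one_of_one_lt₀ (by linarith)
  set κ : ℝ := Real.exp (β * Real.log k) with hκ
  have hκ1 : 1 < κ := Real.one_lt_exp_iff.2 (by positivity)
  have hκk : κ < k := by
    rw [hκ, ← Real.lt_log_iff_exp_lt hk0]
    exact mul_lt_of_lt_one_left hlogk hβ1
  obtain ⟨ξ, hξ0, hξ1, hξκ⟩ : ∃ ξ : ℝ, 0 < ξ ∧ ξ < 1 ∧ (1 - ξ) ^ 2 * k = κ := by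
    refine ⟨1 - √(κ / k), ?_, ?_, ?_⟩
    · rw [sub_pos, Real.sqrt_lt' one_pos, one_pow, div_lt_one hk0]
      exact hκk
    · have : 0 < √(κ / k) := Real.sqrt_pos.2 (by positivity)
      linarith
    · rw [sub_sub_cancel, Real.sq_sqrt (by positivity), div_mul_cancel₀ _ hk0.ne']
  obtain ⟨s, hs⟩ : ∃ s : ℕ, (1 - ξ / k) ^ s < η := by
    refine exists_pow_lt_of_lt_one hη ?_
    have : 0 < ξ / k := by positivity
    linarith
  set c : ℝ := 2 / (ξ ^ 2 * η) with hc
  have hc0 : 0 < c := by positivity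
  obtain ⟨M, hMη, hM⟩ := (((tendsto_const_div_atTop_nhds_zero_nat
    (c * (1 - κ⁻¹)⁻¹)).eventually_le_const hη).and (eventually_gt_atTop 0)).exists
  obtain ⟨R, hRη, hR⟩ := (((tendsto_const_div_atTop_nhds_zero_nat
    (Real.exp (2 * k * M))).eventually_le_const hη).and (eventually_gt_atTop 0)).exists
  have hloglim : Tendsto (fun n : ℕ => c * ((1 + ε) / Real.log k * (k / ξ)) *
      (Real.log n / n)) atTop (nhds 0) := by
    have h := (Real.isLittleO_log_id_atTop.tendsto_div_nhds_zero.comp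
      tendsto_natCast_atTop_atTop).const_mul (c * ((1 + ε) / Real.log k * (k / ξ)))
    rw [mul_zero] at h
    exact h
  have hlin : Tendsto (fun n : ℕ => η * n) atTop atTop :=
    tendsto_natCast_atTop_atTop.const_mul_atTop hη
  have htyp := (tendsto_typical_atTop hk).const_mul_atTop (half_pos hε)
  filter_upwards [hloglim.eventually_le_const hη, hlin.eventually_ge_atTop (2 * (M : ℝ)),
    htyp.eventually_ge_atTop ((R : ℝ) + s + 2), eventually_gt_atTop 0] with n hnlog hnM hnR hn
  have hn' : (0 : ℝ) < n := by exact_mod_cast hn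
  have hexp := exp_log_mul_typical hk hn
  set ℓ := Real.log n / Real.log k with hℓ
  have hℓ0 : 0 ≤ ℓ := div_nonneg (Real.log_natCast_nonneg n) (Real.log_natCast_nonneg k)
  set J := ⌈(1 + ε / 2) * ℓ⌉₊ with hJ
  have hJle : (J : ℝ) ≤ (1 + ε / 2) * ℓ + 1 := (Nat.ceil_lt_add_one (by positivity)).le
  have hnJ : (n : ℝ) ≤ M * κ ^ J := by
    have h1 : (n : ℝ) ≤ κ ^ J := by
      rw [← hexp, hκ, ← Real.exp_nat_mul]
      refine Real.exp_le_exp.2 ?_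
      calc Real.log k * ℓ = ((1 + ε / 2) * ℓ) * (β * Real.log k) := by rw [hβ]; field_simp
        _ ≤ _ := mul_le_mul_of_nonneg_right (Nat.le_ceil _) (by positivity)
    have hM1 : (1 : ℝ) ≤ M := by exact_mod_cast hM
    exact h1.trans (le_mul_of_one_le_left (by positivity) hM1)
  have hlen : ((R + (J + s) + 1 : ℕ) : ℝ) ≤ (1 + ε) * ℓ := by
    push_cast
    linarith
  have hfar := prob2_far_le M R J s hn (by omega) hM hR hξ0 hξ1 (by rwa [hξκ]) hη hs
    (by rwa [hξκ]) hnM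
  rw [hξκ] at hfar
  refine le_trans (prob2_mono ?_) (hfar.trans ?_)
  · rintro f u v ⟨h, hd, hh⟩
    exact ⟨h, hd, Nat.cast_le.1 (hlen.trans hh)⟩
  · have hJs : ((J + s : ℕ) : ℝ) ≤ (1 + ε) * ℓ := by
      refine le_trans (Nat.cast_le.2 ?_) hlen
      omega
    have h1 : c * (((J + s : ℕ) : ℝ) * (k / (ξ * n))) ≤ η := by
      refine le_trans ?_ hnlog
      calc c * (((J + s : ℕ) : ℝ) * (k / (ξ * n))) ≤ c * ((1 + ε) * ℓ * (k / (ξ * n))) := by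
            gcongr
        _ = _ := by rw [hℓ]; field_simp
    rw [mul_div_assoc] at hMη
    rw [mul_add]
    linarith

end Asymptotics

/-- Typical distance: conditioned on `H_n = dist(v₁,v₂) < ∞`,
`H_n / log_k n → 1` in probability. -/
theorem typical_distance (k : ℕ) (hk : 2 ≤ k) (ε : ℝ) (hε : 0 < ε) :
    Filter.Tendsto (fun n : ℕ =>
      prob2 n k (fun f v₁ v₂ => ∃ h : ℕ, pathDist f v₁ v₂ = (h : ℕ∞) ∧
          ε < |(h : ℝ) / (Real.log n / Real.log k) - 1|) /
        prob2 n k (fun f v₁ v₂ => pathDist f v₁ v₂ ≠ ⊤))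
      Filter.atTop (nhds 0) := by
  have hk' : (1 : ℝ) < k := by exact_mod_cast hk
  refine (nhds_basis_zero_abs_lt ℝ).tendsto_right_iff.2 fun δ hδ => ?_
  have hε' : 0 < min ε (1 / 2) := lt_min hε (by norm_num)
  have hη : 0 < δ / 180 := by positivity
  filter_upwards [eventually_prob2_near_le hk hε'
      ((min_le_right ε (1 / 2)).trans_lt (by norm_num)) hη,
    eventually_prob2_far_le hk hε hη, (tendsto_typical_atTop hk).eventually_gt_atTop 0,
    eventually_gt_atTop 0] with n hnear hfar hℓ hn
  have hden := le_prob2_reachable hk hn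
  have hnum := (prob2_mono (n := n) (k := k) (P := fun f v₁ v₂ => ∃ h : ℕ,
    pathDist f v₁ v₂ = (h : ℕ∞) ∧ ε < |(h : ℝ) / (Real.log n / Real.log k) - 1|)
    (Q := fun f u v => (∃ h : ℕ, pathDist f u v = (h : ℕ∞) ∧
      (h : ℝ) < (1 - min ε (1 / 2)) * (Real.log n / Real.log k)) ∨
      ∃ h : ℕ, pathDist f u v = (h : ℕ∞) ∧ (1 + ε) * (Real.log n / Real.log k) ≤ h) (by
    rintro f u v ⟨h, hd, hh⟩
    rcases lt_abs.1 hh with hh | hh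
    · refine Or.inr ⟨h, hd, ?_⟩
      rw [← le_div_iff₀ hℓ]
      linarith
    · refine Or.inl ⟨h, hd, ?_⟩
      rw [← div_lt_iff₀ hℓ]
      linarith [min_le_left ε (1 / 2)])).trans (prob2_or_le _ _)
  rw [abs_of_nonneg (div_nonneg (prob2_nonneg _) (prob2_nonneg _)), div_lt_iff₀ (by linarith)]
  have := mul_le_mul_of_nonneg_left hden hδ.le
  linarith
end

section
/- Fix an integer k ≥ 2. Then: (a) there is exactly one τ > 0 satisfying 1 − τ/k − e^{−τ} = 0; call it τ_k; (b) 0 < k − τ_k < 1/2; (c) 1/2 < 1 − 1/(2k) < τ_k/k < 1. -/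
theorem four_lt_exp_three_halves : (4 : ℝ) < Real.exp (3 / 2) := by
  have h1 : Real.exp (3 / 2) ^ 2 = Real.exp 1 ^ 3 := by
    rw [← Real.exp_nat_mul, ← Real.exp_nat_mul]
    norm_num
  have h2 : (2.7 : ℝ) ^ 3 < Real.exp 1 ^ 3 := by
    gcongr
    linarith [Real.exp_one_gt_d9]
  nlinarith [Real.exp_pos (3 / 2)]

theorem two_mul_lt_exp_sub_half {x : ℝ} (hx : 2 ≤ x) : 2 * x < Real.exp (x - 1 / 2) := by
  have h : Real.exp (x - 1 / 2) = Real.exp (3 / 2) * Real.exp (x - 2) := by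
    rw [← Real.exp_add]
    ring_nf
  rw [h]
  nlinarith [Real.add_one_le_exp (x - 2), four_lt_exp_three_halves]

/-- Two positive zeros of `1 - x / c - exp (-x)` cannot be distinct, as this function is strictly
concave and vanishes at `0`. -/
theorem not_lt_of_one_sub_div_sub_exp_neg_eq_zero {c x y : ℝ} (hx : 0 < x)
    (hfx : 1 - x / c - Real.exp (-x) = 0) (hfy : 1 - y / c - Real.exp (-y) = 0) : ¬ x < y := by
  intro hxy
  have hy : 0 < y := hx.trans hxy
  have h := strictConvexOn_exp.2 (Set.mem_univ (-y)) (Set.mem_univ 0) (by linarith)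
    (div_pos hx hy) (sub_pos.2 ((div_lt_one hy).2 hxy)) (by ring)
  have e : x / y * -y = -x := by field_simp
  have e' : x / y * (y / c) = x / c := by
    rw [div_mul_div_cancel₀ hy.ne']
  simp only [smul_eq_mul, mul_zero, add_zero, Real.exp_zero, mul_one, e] at h
  rw [show Real.exp (-y) = 1 - y / c by linarith, mul_sub, e'] at h
  linarith

theorem exists_one_sub_div_sub_exp_neg_eq_zero {c : ℝ} (hc : 2 ≤ c) :
    ∃ x ∈ Set.Ioo (c - 1 / 2) c, 1 - x / c - Real.exp (-x) = 0 := by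
  have hc0 : 0 < c := by linarith
  refine intermediate_value_Ioo' (by linarith : c - 1 / 2 ≤ c)
    (f := fun x => 1 - x / c - Real.exp (-x)) (by fun_prop) ⟨?_, ?_⟩
  · simp only [div_self hc0.ne']
    linarith [Real.exp_pos (-c)]
  · have h : Real.exp (-(c - 1 / 2)) < 1 / (2 * c) := by
      rw [Real.exp_neg, ← one_div]
      exact one_div_lt_one_div_of_lt (by linarith) (two_mul_lt_exp_sub_half hc)
    have e : 1 - (c - 1 / 2) / c = 1 / (2 * c) := by
      field_simp
      ring
    simp only [e]
    linarith


/-- For every integer `k ≥ 2`: (a) there is exactly one `τ > 0` with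
`1 - τ/k - e^{-τ} = 0`; (b) it satisfies `0 < k - τ < 1/2`; and
(c) `1/2 < 1 - 1/(2k) < τ/k < 1`. -/
theorem tau_exists_unique_and_bounds (k : ℕ) (hk : 2 ≤ k) :
    (∃! τ : ℝ, 0 < τ ∧ 1 - τ / k - Real.exp (-τ) = 0) ∧
    ∀ τ : ℝ, 0 < τ → 1 - τ / k - Real.exp (-τ) = 0 →
      0 < (k : ℝ) - τ ∧ (k : ℝ) - τ < 1 / 2 ∧
      1 / 2 < 1 - 1 / (2 * (k : ℝ)) ∧ 1 - 1 / (2 * (k : ℝ)) < τ / k ∧ τ / k < 1 := by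
  have hc : (2 : ℝ) ≤ k := by exact_mod_cast hk
  have hc0 : (0 : ℝ) < k := by linarith
  obtain ⟨t, ⟨ht1, ht2⟩, ht⟩ := exists_one_sub_div_sub_exp_neg_eq_zero hc
  have ht0 : 0 < t := by linarith
  have huniq : ∀ s : ℝ, 0 < s → 1 - s / k - Real.exp (-s) = 0 → s = t := fun s hs0 hs =>
    le_antisymm (not_lt.1 (not_lt_of_one_sub_div_sub_exp_neg_eq_zero ht0 ht hs))
      (not_lt.1 (not_lt_of_one_sub_div_sub_exp_neg_eq_zero hs0 hs ht))
  refine ⟨⟨t, ⟨ht0, ht⟩, fun s hs => huniq s hs.1 hs.2⟩, fun s hs0 hs => ?_⟩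
  rw [huniq s hs0 hs]
  refine ⟨by linarith, by linarith, ?_, ?_, (div_lt_one hc0).2 ht2⟩
  · have : 1 / (2 * (k : ℝ)) < 1 / 2 := one_div_lt_one_div_of_lt (by norm_num) (by linarith)
    linarith
  · rw [lt_div_iff₀ hc0]
    have : (1 - 1 / (2 * (k : ℝ))) * k = k - 1 / 2 := by field_simp
    linarith
end

section
/- Fix an integer k ≥ 2 and let τ_k be the unique positive solution of 1 − τ/k − e^{−τ} = 0. Then the following three constants are all strictly less than 1: λ_k = (k − τ_k)(τ_k/(k−1))^{k−1}; γ_k = (k/(e τ_k))^k (e^{τ_k} − 1); and ρ_k = k e^{1−τ_k} (τ_k/k)^{k−1}. Moreover λ_k < (k − τ_k) e^{1 − k + τ_k} < 1. -/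
/-- A positive solution of `e^{-t} = 1 - t/(n+1)` exceeds `n`. -/
lemma lt_of_exp_neg_eq {n t : ℝ} (hn : 0 < n) (ht : 0 < t)
    (h : 1 - t / (n + 1) - Real.exp (-t) = 0) : n < t := by
  by_contra! hle
  have hs : 0 < t / n := div_pos ht hn
  have hconv := convexOn_exp.2 (Set.mem_univ 0) (Set.mem_univ (-n))
    (sub_nonneg.2 ((div_le_one hn).2 hle)) hs.le (sub_add_cancel 1 (t / n))
  simp only [smul_eq_mul, mul_zero, zero_add, Real.exp_zero, mul_one] at hconv
  rw [show t / n * -n = -t by field_simp] at hconv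
  have hexp : Real.exp (-n) < (n + 1)⁻¹ := by
    rw [Real.exp_neg]
    exact inv_strictAnti₀ (by positivity) (Real.add_one_lt_exp hn.ne')
  have hmul := mul_lt_mul_of_pos_left hexp hs
  have hid : 1 - t / n + t / n * (n + 1)⁻¹ = 1 - t / (n + 1) := by
    field_simp
    ring
  linarith

/-- `t^n` is dominated by `n^n e^{t-n}`, strictly away from `t = n`. -/
lemma div_pow_lt_exp_sub {n : ℕ} (hn : n ≠ 0) {t : ℝ} (ht : 0 ≤ t) (hne : t ≠ n) :
    (t / n) ^ n < Real.exp (t - n) := by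
  have hn' : (n : ℝ) ≠ 0 := by exact_mod_cast hn
  have hlt : t / n < Real.exp (t / n - 1) := by
    have := Real.add_one_lt_exp (x := t / n - 1) (by
      rw [sub_ne_zero, Ne, div_eq_one_iff_eq hn']
      exact hne)
    linarith
  calc (t / n) ^ n < Real.exp (t / n - 1) ^ n := pow_lt_pow_left₀ hlt (by positivity) hn
    _ = Real.exp (t - n) := by
      rw [← Real.exp_nat_mul]
      congr 1
      field_simp

/-- For `k ≥ 2` and `τ_k` the unique positive solution of `1 - τ/k - e^{-τ} = 0`,
the constants `λ_k = (k-τ_k)(τ_k/(k-1))^{k-1}`,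
`γ_k = (k/(e τ_k))^k (e^{τ_k} - 1)` and `ρ_k = k e^{1-τ_k} (τ_k/k)^{k-1}`
are all `< 1`; moreover `λ_k < (k-τ_k) e^{1-k+τ_k} < 1`. -/
theorem constants_lt_one (k : ℕ) (hk : 2 ≤ k) (τ : ℝ) (hτpos : 0 < τ)
    (hτ : 1 - τ / k - Real.exp (-τ) = 0) :
    ((k : ℝ) - τ) * (τ / ((k : ℝ) - 1)) ^ (k - 1) < 1 ∧
    ((k : ℝ) / (Real.exp 1 * τ)) ^ k * (Real.exp τ - 1) < 1 ∧
    (k : ℝ) * Real.exp (1 - τ) * (τ / (k : ℝ)) ^ (k - 1) < 1 ∧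
    ((k : ℝ) - τ) * (τ / ((k : ℝ) - 1)) ^ (k - 1) <
      ((k : ℝ) - τ) * Real.exp (1 - (k : ℝ) + τ) ∧
    ((k : ℝ) - τ) * Real.exp (1 - (k : ℝ) + τ) < 1 := by
  obtain ⟨m, rfl⟩ := Nat.exists_eq_add_of_le' hk
  have hcast : ((m + 2 : ℕ) : ℝ) = ((m + 1 : ℕ) : ℝ) + 1 := by push_cast; ring
  have hsub : m + 2 - 1 = m + 1 := rfl
  rw [hcast] at hτ ⊢
  rw [hsub, add_sub_cancel_right]
  have hm1 : (m : ℝ) + 1 = ((m + 1 : ℕ) : ℝ) := by push_cast; ring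
  have hn : (0 : ℝ) < ((m + 1 : ℕ) : ℝ) := by positivity
  have hlt := lt_of_exp_neg_eq hn hτpos hτ
  have hpow := div_pow_lt_exp_sub m.succ_ne_zero hτpos.le hlt.ne'
  rw [Nat.succ_eq_add_one] at hpow
  generalize hN : ((m + 1 : ℕ) : ℝ) = n at *
  have hδ : 0 < n + 1 - τ := by
    have h1 : τ / (n + 1) < 1 := by linarith [Real.exp_pos (-τ)]
    rw [div_lt_one (by positivity)] at h1
    linarith
  have hlam : (n + 1 - τ) * (τ / n) ^ (m + 1) <
      (n + 1 - τ) * Real.exp (1 - (n + 1) + τ) := by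
    rw [show 1 - (n + 1) + τ = τ - n by ring]
    exact mul_lt_mul_of_pos_left hpow hδ
  have hmid : (n + 1 - τ) * Real.exp (1 - (n + 1) + τ) < 1 := by
    have h1 := Real.add_one_lt_exp (x := n - τ) (by linarith)
    calc (n + 1 - τ) * Real.exp (1 - (n + 1) + τ)
        < Real.exp (n - τ) * Real.exp (1 - (n + 1) + τ) :=
          mul_lt_mul_of_pos_right (by linarith) (Real.exp_pos _)
      _ = 1 := by rw [← Real.exp_add]; ring_nf; exact Real.exp_zero
  refine ⟨hlam.trans hmid, ?_, ?_, hlam, hmid⟩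
  · have hexp : Real.exp τ - 1 = Real.exp τ * (τ / (n + 1)) := by
      rw [show τ / (n + 1) = 1 - Real.exp (-τ) by linarith, mul_sub, ← Real.exp_add]
      simp
    have hbase : (n + 1) / τ ≤ Real.exp ((n + 1 - τ) / τ) := by
      refine le_of_eq_of_le ?_ (Real.add_one_le_exp _)
      field_simp
      ring
    have hbound : ((n + 1) / τ) ^ (m + 1) < Real.exp (n + 1 - τ) := by
      refine (pow_le_pow_left₀ (by positivity) hbase _).trans_lt ?_
      rw [← Real.exp_nat_mul, hN, Real.exp_lt_exp, mul_div_assoc', div_lt_iff₀ hτpos, mul_comm]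
      exact mul_lt_mul_of_pos_left hlt hδ
    calc ((n + 1) / (Real.exp 1 * τ)) ^ (m + 2) * (Real.exp τ - 1)
        = ((n + 1) / τ) ^ (m + 1) * (Real.exp τ / Real.exp 1 ^ (m + 2)) := by
          rw [hexp, pow_succ _ (m + 1), pow_succ _ (m + 1), div_pow, div_pow, mul_pow]
          field_simp
      _ = ((n + 1) / τ) ^ (m + 1) * Real.exp (τ - (n + 1)) := by
          rw [← Real.exp_nat_mul, mul_one, hcast, Real.exp_sub]
      _ < Real.exp (n + 1 - τ) * Real.exp (τ - (n + 1)) :=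
          mul_lt_mul_of_pos_right hbound (Real.exp_pos _)
      _ = 1 := by rw [← Real.exp_add]; ring_nf; exact Real.exp_zero
  · calc (n + 1) * Real.exp (1 - τ) * (τ / (n + 1)) ^ (m + 1)
        = (n + 1) * Real.exp (1 - τ) * (n / (n + 1)) ^ (m + 1) * (τ / n) ^ (m + 1) := by
          rw [mul_assoc _ (_ ^ _) (_ ^ _), ← mul_pow]
          congr 2
          field_simp
      _ < (n + 1) * Real.exp (1 - τ) * (n / (n + 1)) ^ (m + 1) * Real.exp (τ - n) :=
          mul_lt_mul_of_pos_left hpow (by positivity)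
      _ = (n / (n + 1)) ^ m * (n * Real.exp (1 - n)) := by
          rw [show 1 - n = (1 - τ) + (τ - n) by ring, Real.exp_add, pow_succ]
          field_simp
      _ ≤ 1 * (Real.exp (n - 1) * Real.exp (1 - n)) := by
          gcongr
          · exact pow_le_one₀ (by positivity) ((div_le_one (by positivity)).2 (by linarith))
          · linarith [Real.add_one_le_exp (n - 1)]
      _ = 1 := by rw [one_mul, ← Real.exp_add]; ring_nf; exact Real.exp_zero
end

section
/- Let k ≥ 2 be an integer and μ a real number with 0 < μ < 1/(2k). Define φ_1 : ℝ → ℝ by φ_1(y) = (1 − μ(1 − y))^k, and define φ_{m+1} = φ_1 ∘ φ_m for m ≥ 1. Then for every integer m ≥ 1, φ_m(0) ≤ 1 − (kμ)^m + (1 − 2^{−m})(kμ)^{m+1}. (φ_m is the probability generating function of the m-th generation of a Galton–Watson process with Binomial(k, μ) offspring distribution started from one individual, so φ_m(0) is its extinction probability by generation m.) -/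
/-- A second-order upper bound complementing Bernoulli's inequality. -/
theorem one_sub_pow_le_quadratic {t : ℝ} (ht0 : 0 ≤ t) (ht1 : t ≤ 1) (n : ℕ) :
    (1 - t) ^ n ≤ 1 - n * t + (n * t) ^ 2 / 2 := by
  induction n with
  | zero => simp
  | succ n ih =>
    have h := mul_le_mul_of_nonneg_right ih (sub_nonneg.2 ht1)
    have h' : 0 ≤ (n : ℝ) ^ 2 * t ^ 3 := by positivity
    rw [pow_succ]
    push_cast
    nlinarith [sq_nonneg t]

/-- Two-sided bounds for the survival probability of a Galton–Watson process with `Bin(k, μ)`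
offspring distribution and mean `kμ ≤ 1/2`. -/
theorem gw_survival_bounds (k : ℕ) {μ : ℝ} (hμ0 : 0 ≤ μ) (hμ1 : μ ≤ 1)
    (hx : k * μ ≤ 1 / 2) (m : ℕ) :
    let q := 1 - (fun y : ℝ => (1 - μ * (1 - y)) ^ k)^[m] 0
    0 ≤ q ∧ q ≤ (k * μ) ^ m ∧
      (k * μ) ^ m - (1 - (1 / 2 : ℝ) ^ m) * (k * μ) ^ (m + 1) ≤ q := by
  induction m with
  | zero => simp
  | succ m ih =>
    simp only [Function.iterate_succ_apply'] at ih ⊢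
    set q := 1 - (fun y : ℝ => (1 - μ * (1 - y)) ^ k)^[m] 0
    obtain ⟨hq0, hqx, hq⟩ := ih
    have hx0 : 0 ≤ k * μ := by positivity
    have hq1 : q ≤ 1 := hqx.trans (pow_le_one₀ hx0 (by linarith))
    have ht0 : 0 ≤ μ * q := by positivity
    have ht1 : μ * q ≤ 1 := mul_le_one₀ hμ1 hq0 hq1
    have hbern := one_add_mul_le_pow (a := -(μ * q)) (by linarith) k
    have hquad := one_sub_pow_le_quadratic ht0 ht1 k
    have hpow : (k * μ) ^ m ≤ (1 / 2 : ℝ) ^ m := pow_le_pow_left₀ hx0 hx m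
    rw [← sub_eq_add_neg] at hbern
    rw [← mul_assoc] at hquad
    set x := (k : ℝ) * μ
    refine ⟨sub_nonneg.2 (pow_le_one₀ (by linarith) (by linarith)), ?_, ?_⟩
    · have h := mul_le_mul_of_nonneg_left hqx hx0
      rw [pow_succ']
      linarith
    · have h := mul_le_mul_of_nonneg_left hq hx0
      have hsq : (x * q) ^ 2 ≤ (x * x ^ m) ^ 2 := by gcongr
      have herr := mul_le_mul_of_nonneg_right hpow (show 0 ≤ x ^ 2 * x ^ m by positivity)
      simp only [pow_succ] at h hsq herr ⊢
      linarith

/-- For a Galton–Watson process with `Bin(k, μ)` offspring distribution,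
`0 < μ < 1/(2k)`, the generating function `φ_m = φ_1^[m]` with
`φ_1(y) = (1 - μ(1-y))^k` satisfies
`φ_m(0) ≤ 1 - (kμ)^m + (1 - 2^{-m})(kμ)^{m+1}` for every `m ≥ 1`. -/
theorem gw_extinction_pgf_bound (k : ℕ) (hk : 2 ≤ k) (μ : ℝ) (hμ0 : 0 < μ)
    (hμ : μ < 1 / (2 * (k : ℝ))) (m : ℕ) (hm : 1 ≤ m) :
    (fun y : ℝ => (1 - μ * (1 - y)) ^ k)^[m] 0 ≤
      1 - ((k : ℝ) * μ) ^ m + (1 - (1 / 2 : ℝ) ^ m) * ((k : ℝ) * μ) ^ (m + 1) := by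
  have hk0 : (2 : ℝ) ≤ k := by exact_mod_cast hk
  rw [lt_div_iff₀ (by positivity)] at hμ
  have h := (gw_survival_bounds k hμ0.le (by nlinarith) (by linarith) m).2.2
  linarith
end
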